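/- arXiv:1310.1789 — 4 statements merged into one kernel-verified Lean document; each statement's English description precedes it below -/
import Mathlib

section
/- Let μ be of separated type and assume τ_1 and τ_2 are differentiable at q = 1. Then γ is differentiable at q = 1, with γ'(1) = min{γ_A'(1), γ_B'(1)} if min{γ_A'(1), γ_B'(1)} ≥ τ_1'(1)+τ_2'(1), and γ'(1) = max{γ_A'(1), γ_B'(1)} if max{γ_A'(1), γ_B'(1)} ≤ τ_1'(1)+τ_2'(1). -/
open MeasureTheory Filter Set

attribute [local instance] Classical.propDecidable

noncomputable section

/-- Data of a box-like planar self-affine IFS: each map is `S i = T i ∘ L i + t i`, where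
`T i` is the diagonal contraction `diag (c i, d i)` with `c i, d i ∈ (0,1)` and `L i` is a
linear isometry of the plane preserving `[-1,1]²`, i.e. one of the eight symmetries of the
square, encoded by whether it swaps the two axes (`swap`) and by a sign on each coordinate. -/
structure IFSData (ι : Type) where
  c : ι → ℝ
  d : ι → ℝ
  swap : ι → Bool
  sgn1 : ι → Bool
  sgn2 : ι → Bool
  t : ι → ℝ × ℝ

namespace IFSData

variable {ι : Type}

/-- The affine contraction `S i = T i ∘ L i + t i`. -/
def S (B : IFSData ι) (i : ι) (x : ℝ × ℝ) : ℝ × ℝ :=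
  ((if B.sgn1 i then 1 else -1) * (B.c i * (if B.swap i then x.2 else x.1)) + (B.t i).1,
   (if B.sgn2 i then 1 else -1) * (B.d i * (if B.swap i then x.1 else x.2)) + (B.t i).2)

/-- `(b(i), h(i))`: base and height of the rectangle `S_i([0,1]²)` for a finite word `i`. -/
def dims (B : IFSData ι) (l : List ι) : ℝ × ℝ :=
  l.foldr (fun i w =>
    (B.c i * (if B.swap i then w.2 else w.1), B.d i * (if B.swap i then w.1 else w.2))) (1, 1)

/-- `α₁(i)`: the larger singular value of the linear part of `S_i`. -/
def alpha1 (B : IFSData ι) (l : List ι) : ℝ := max (B.dims l).1 (B.dims l).2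

/-- `α₂(i)`: the smaller singular value of the linear part of `S_i`. -/
def alpha2 (B : IFSData ι) (l : List ι) : ℝ := min (B.dims l).1 (B.dims l).2

/-- Whether the composite map of the word maps horizontal lines to vertical lines. -/
def swapW (B : IFSData ι) (l : List ι) : Bool := l.foldr (fun i b => xor (B.swap i) b) false

/-- The composite map `S_{i₁} ∘ ⋯ ∘ S_{i_k}` of a word. -/
def Sw (B : IFSData ι) (l : List ι) : ℝ × ℝ → ℝ × ℝ := l.foldr (fun i f => B.S i ∘ f) id

/-- The word `i` projects onto the first coordinate, i.e. `π_i = π₁`. -/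
def usesPi1 (B : IFSData ι) (l : List ι) : Prop :=
  (B.swapW l = false ∧ (B.dims l).2 ≤ (B.dims l).1) ∨
    (B.swapW l = true ∧ (B.dims l).1 < (B.dims l).2)

/-- The projection `π_i` onto the direction of the longest side of `S_i([0,1]²)`. -/
def projW (B : IFSData ι) (l : List ι) : ℝ × ℝ → ℝ :=
  if B.usesPi1 l then Prod.fst else Prod.snd

/-- The rectangular open set condition. -/
def ROSC (B : IFSData ι) : Prop :=
  ∃ x₁ x₂ y₁ y₂ : ℝ, x₁ < x₂ ∧ y₁ < y₂ ∧
    (∀ i, B.S i '' (Set.Ioo x₁ x₂ ×ˢ Set.Ioo y₁ y₂) ⊆ Set.Ioo x₁ x₂ ×ˢ Set.Ioo y₁ y₂) ∧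
    Pairwise fun i j =>
      Disjoint (B.S i '' (Set.Ioo x₁ x₂ ×ˢ Set.Ioo y₁ y₂))
        (B.S j '' (Set.Ioo x₁ x₂ ×ˢ Set.Ioo y₁ y₂))

end IFSData

/-- `p(i)`: the probability of a finite word. -/
def wordProb {ι : Type} (p : ι → ℝ) (l : List ι) : ℝ := (l.map p).prod

/-- `τ_i(q)`: the value of the `L^q`-spectrum of the projection `π_i μ`. -/
def tauW {ι : Type} (B : IFSData ι) (τ1 τ2 : ℝ → ℝ) (l : List ι) (q : ℝ) : ℝ :=
  if B.usesPi1 l then τ1 q else τ2 q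

/-- The `q`-modified singular value function `ψ^{s,q}`. -/
def psiSV {ι : Type} (B : IFSData ι) (p : ι → ℝ) (τ1 τ2 : ℝ → ℝ) (s q : ℝ) (l : List ι) : ℝ :=
  wordProb p l ^ q * B.alpha1 l ^ tauW B τ1 τ2 l q * B.alpha2 l ^ (s - tauW B τ1 τ2 l q)

/-- `Ψ_k^{s,q} = ∑_{i ∈ I^k} ψ^{s,q}(i)`. -/
def PsiSV {ι : Type} [Fintype ι] (B : IFSData ι) (p : ι → ℝ) (τ1 τ2 : ℝ → ℝ)
    (k : ℕ) (s q : ℝ) : ℝ :=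
  ∑ f : Fin k → ι, psiSV B p τ1 τ2 s q (List.ofFn f)

/-- The lower `L^q`-spectrum of a measure. -/
def lowerLq {X : Type*} [MeasurableSpace X] [PseudoMetricSpace X] (ν : Measure X) (q : ℝ) : ℝ :=
  liminf (fun δ : ℝ =>
      Real.log (∫ x, (ν (Metric.ball x δ)).toReal ^ (q - 1) ∂ν) / (-Real.log δ))
    (nhdsWithin 0 (Set.Ioi 0))

/-- The upper `L^q`-spectrum of a measure. -/
def upperLq {X : Type*} [MeasurableSpace X] [PseudoMetricSpace X] (ν : Measure X) (q : ℝ) : ℝ :=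
  limsup (fun δ : ℝ =>
      Real.log (∫ x, (ν (Metric.ball x δ)).toReal ^ (q - 1) ∂ν) / (-Real.log δ))
    (nhdsWithin 0 (Set.Ioi 0))

/-- The `L^q`-spectrum of `ν` exists and equals `t`. -/
def IsLqSpec {X : Type*} [MeasurableSpace X] [PseudoMetricSpace X]
    (ν : Measure X) (q t : ℝ) : Prop :=
  lowerLq ν q = t ∧ upperLq ν q = t

/-- `α_min = min_{i ∈ I} α₂(i)`. -/
def alphaMin {ι : Type} [Fintype ι] [Nonempty ι] (B : IFSData ι) : ℝ :=
  Finset.univ.inf' Finset.univ_nonempty fun i => min (B.c i) (B.d i)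

/-- `α_max = max_{i ∈ I} α₁(i)`. -/
def alphaMax {ι : Type} [Fintype ι] [Nonempty ι] (B : IFSData ι) : ℝ :=
  Finset.univ.sup' Finset.univ_nonempty fun i => max (B.c i) (B.d i)

/-- `p_max = max_{i ∈ I} p_i`. -/
def pMax {ι : Type} [Fintype ι] [Nonempty ι] (p : ι → ℝ) : ℝ :=
  Finset.univ.sup' Finset.univ_nonempty p

/-- The `δ`-stopping `I_δ`. -/
def stopping {ι : Type} (B : IFSData ι) (δ : ℝ) : Set (List ι) :=
  {l | l ≠ [] ∧ B.alpha2 l < δ ∧ δ ≤ B.alpha2 l.dropLast}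

/-- Logarithmic form of `Ψ_k^{s,q}`. -/
def GG {ι : Type} [Fintype ι] (a x y : ι → ℝ) (t1 t2 s q : ℝ) (k : ℕ) : ℝ :=
  ∑ f : Fin k → ι, Real.exp (q * (∑ j, a (f j)) + t1 * (∑ j, x (f j))
    + (s - t1) * (∑ j, y (f j)) - (s - t1 - t2) * max 0 ((∑ j, y (f j)) - ∑ j, x (f j)))

theorem GG_symm {ι : Type} [Fintype ι] (a x y : ι → ℝ) (t1 t2 s q : ℝ) (k : ℕ) :
    GG a x y t1 t2 s q k = GG a y x t2 t1 s q k := by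
  unfold GG
  refine Finset.sum_congr rfl fun f _ => ?_
  congr 1
  set X := ∑ j, x (f j)
  set Y := ∑ j, y (f j)
  rcases le_total X Y with h | h
  · rw [max_eq_right (by linarith), max_eq_left (by linarith)]; ring
  · rw [max_eq_left (by linarith), max_eq_right (by linarith)]; ring

theorem sum_exp_eq_pow {ι : Type} [Fintype ι] (w : ι → ℝ) (k : ℕ) :
    ∑ f : Fin k → ι, Real.exp (∑ j, w (f j)) = (∑ i, Real.exp (w i)) ^ k := by
  rw [Fintype.sum_pow]
  refine Finset.sum_congr rfl fun f _ => ?_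
  rw [Real.exp_sum]

theorem GG_nonneg {ι : Type} [Fintype ι] (a x y : ι → ℝ) (t1 t2 s q : ℝ) (k : ℕ) :
    0 ≤ GG a x y t1 t2 s q k := Finset.sum_nonneg fun _ _ => (Real.exp_pos _).le

theorem lin_sum {ι : Type} [Fintype ι] (a x y : ι → ℝ) (u v w : ℝ) (k : ℕ) (f : Fin k → ι) :
    ∑ j, (u * a (f j) + v * x (f j) + w * y (f j)) =
      u * (∑ j, a (f j)) + v * (∑ j, x (f j)) + w * (∑ j, y (f j)) := by
  simp only [Finset.sum_add_distrib, Finset.mul_sum]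

theorem GG_le_A {ι : Type} [Fintype ι] (a x y : ι → ℝ) (t1 t2 s q : ℝ) (k : ℕ)
    (h : t1 + t2 ≤ s) :
    GG a x y t1 t2 s q k ≤ (∑ i, Real.exp (q * a i + t1 * x i + (s - t1) * y i)) ^ k := by
  rw [← sum_exp_eq_pow (fun i => q * a i + t1 * x i + (s - t1) * y i)]
  unfold GG
  refine Finset.sum_le_sum fun f _ => ?_
  apply Real.exp_le_exp.mpr
  rw [lin_sum]
  have : 0 ≤ (s - t1 - t2) * max 0 ((∑ j, y (f j)) - ∑ j, x (f j)) :=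
    mul_nonneg (by linarith) (le_max_left _ _)
  linarith

theorem GG_le_AB {ι : Type} [Fintype ι] (a x y : ι → ℝ) (t1 t2 s q : ℝ) (k : ℕ) :
    GG a x y t1 t2 s q k ≤ (∑ i, Real.exp (q * a i + t1 * x i + (s - t1) * y i)) ^ k
      + (∑ i, Real.exp (q * a i + t2 * y i + (s - t2) * x i)) ^ k := by
  rw [← sum_exp_eq_pow (fun i => q * a i + t1 * x i + (s - t1) * y i),
    ← sum_exp_eq_pow (fun i => q * a i + t2 * y i + (s - t2) * x i), ← Finset.sum_add_distrib]
  unfold GG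
  refine Finset.sum_le_sum fun f _ => ?_
  rw [lin_sum, lin_sum]
  set X := ∑ j, x (f j)
  set Y := ∑ j, y (f j)
  rcases le_total X Y with h | h
  · rw [max_eq_right (by linarith)]
    refine le_trans (le_of_eq ?_) (le_add_of_nonneg_left (Real.exp_pos _).le)
    congr 1; ring
  · rw [max_eq_left (by linarith)]
    refine le_trans (le_of_eq ?_) (le_add_of_nonneg_right (Real.exp_pos _).le)
    congr 1; ring

theorem not_tendsto_one {G : ℕ → ℝ} (hG0 : ∀ k, 0 ≤ G k) {r : ℝ} (hr0 : 0 ≤ r) (hr : r < 1)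
    (hG : ∀ k, G k ≤ 2 * r ^ k)
    (h : Tendsto (fun k : ℕ => G k ^ ((k : ℝ)⁻¹)) atTop (nhds 1)) : False := by
  have h2 : Tendsto (fun k : ℕ => (2 : ℝ) ^ ((k : ℝ)⁻¹) * r) atTop (nhds (1 * r)) := by
    refine Tendsto.mul_const _ ?_
    have : Tendsto (fun k : ℕ => ((k : ℝ)⁻¹)) atTop (nhds 0) :=
      tendsto_inv_atTop_nhds_zero_nat
    have h3 := (Real.continuous_const_rpow (a := 2) (by norm_num)).tendsto 0
    simpa [Function.comp_def] using h3.comp this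
  have : (1 : ℝ) ≤ 1 * r := by
    refine le_of_tendsto_of_tendsto h h2 ?_
    filter_upwards [eventually_gt_atTop 0] with k hk
    calc G k ^ ((k : ℝ)⁻¹) ≤ (2 * r ^ k) ^ ((k : ℝ)⁻¹) :=
          Real.rpow_le_rpow (hG0 k) (hG k) (by positivity)
      _ = _ := by
          rw [Real.mul_rpow (by norm_num) (by positivity), Real.pow_rpow_inv_natCast hr0 hk.ne']
  linarith

theorem sum_exp_anti {ι : Type} [Fintype ι] [Nonempty ι] (u y : ι → ℝ) (hy : ∀ i, y i < 0)
    {s s' : ℝ} (h : s < s') :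
    ∑ i, Real.exp (u i + s' * y i) < ∑ i, Real.exp (u i + s * y i) := by
  refine Finset.sum_lt_sum_of_nonempty Finset.univ_nonempty fun i _ => ?_
  apply Real.exp_lt_exp.mpr
  nlinarith [hy i]

theorem upper_bound {ι : Type} [Fintype ι] [Nonempty ι] (a x y : ι → ℝ)
    (hx : ∀ i, x i < 0) (hy : ∀ i, y i < 0) (t1 t2 s q gA gB : ℝ)
    (hA : ∑ i, Real.exp (q * a i + t1 * x i + (gA - t1) * y i) = 1)
    (hB : ∑ i, Real.exp (q * a i + t2 * y i + (gB - t2) * x i) = 1)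
    (h : Tendsto (fun k : ℕ => GG a x y t1 t2 s q k ^ ((k : ℝ)⁻¹)) atTop (nhds 1)) :
    s ≤ max gA (min gB (t1 + t2)) := by
  by_contra hcon
  push Not at hcon
  obtain ⟨h1, h2⟩ := max_lt_iff.mp hcon
  have hA' : ∑ i, Real.exp (q * a i + t1 * x i + (s - t1) * y i) < 1 := by
    rw [← hA]
    exact sum_exp_anti (fun i => q * a i + t1 * x i) y hy (by linarith)
  have hA0 : 0 ≤ ∑ i, Real.exp (q * a i + t1 * x i + (s - t1) * y i) :=
    Finset.sum_nonneg fun _ _ => (Real.exp_pos _).le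
  rcases min_lt_iff.mp h2 with h3 | h3
  · have hB' : ∑ i, Real.exp (q * a i + t2 * y i + (s - t2) * x i) < 1 := by
      rw [← hB]
      exact sum_exp_anti (fun i => q * a i + t2 * y i) x hx (by linarith)
    have hB0 : 0 ≤ ∑ i, Real.exp (q * a i + t2 * y i + (s - t2) * x i) :=
      Finset.sum_nonneg fun _ _ => (Real.exp_pos _).le
    refine not_tendsto_one (GG_nonneg a x y t1 t2 s q) (le_max_of_le_left hA0)
      (max_lt hA' hB') (fun k => ?_) h
    refine (GG_le_AB a x y t1 t2 s q k).trans ?_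
    rw [two_mul]
    exact add_le_add (pow_le_pow_left₀ hA0 (le_max_left _ _) k)
      (pow_le_pow_left₀ hB0 (le_max_right _ _) k)
  · refine not_tendsto_one (GG_nonneg a x y t1 t2 s q) hA0 hA' (fun k => ?_) h
    refine (GG_le_A a x y t1 t2 s q k h3.le).trans ?_
    have := pow_nonneg hA0 k
    linarith

theorem prob_sum {ι : Type} [Fintype ι] (p : ι → ℝ) (hp : ∑ i, p i = 1) (k : ℕ) :
    ∑ f : Fin k → ι, ∏ j, p (f j) = 1 := by
  rw [← Fintype.sum_pow, hp, one_pow]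

theorem prob_succ {ι : Type} [Fintype ι] (p : ι → ℝ) (k : ℕ) (F : (Fin (k + 1) → ι) → ℝ) :
    ∑ f : Fin (k + 1) → ι, (∏ j, p (f j)) * F f =
      ∑ i, p i * ∑ f : Fin k → ι, (∏ j, p (f j)) * F (Fin.cons i f) := by
  rw [← (Fin.consEquiv (fun _ => ι)).sum_comp, Fintype.sum_prod_type]
  refine Finset.sum_congr rfl fun i _ => ?_
  rw [Finset.mul_sum]
  refine Finset.sum_congr rfl fun f _ => ?_
  simp [Fin.consEquiv, Fin.prod_univ_succ, mul_assoc]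

theorem prob_mean {ι : Type} [Fintype ι] (p : ι → ℝ) (hp : ∑ i, p i = 1) (w : ι → ℝ) (k : ℕ) :
    ∑ f : Fin k → ι, (∏ j, p (f j)) * (∑ j, w (f j)) = k * ∑ i, p i * w i := by
  induction k with
  | zero => simp
  | succ k ih =>
    rw [prob_succ]
    simp only [Fin.sum_univ_succ, Fin.cons_zero, Fin.cons_succ, mul_add, Finset.sum_add_distrib]
    rw [ih]
    simp only [← Finset.sum_mul, prob_sum p hp k, hp]
    push_cast
    ring

theorem prob_var {ι : Type} [Fintype ι] (p : ι → ℝ) (hp : ∑ i, p i = 1) (w : ι → ℝ)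
    (hw : ∑ i, p i * w i = 0) (k : ℕ) :
    ∑ f : Fin k → ι, (∏ j, p (f j)) * (∑ j, w (f j)) ^ 2 = k * ∑ i, p i * w i ^ 2 := by
  induction k with
  | zero => simp
  | succ k ih =>
    rw [prob_succ]
    have key : ∀ i, ∑ f : Fin k → ι, (∏ j, p (f j)) *
        (∑ j, w ((Fin.cons i f : Fin (k + 1) → ι) j)) ^ 2
        = w i ^ 2 + k * ∑ i, p i * w i ^ 2 := by
      intro i
      have e : ∀ f : Fin k → ι, (∏ j, p (f j)) *
          (∑ j, w ((Fin.cons i f : Fin (k + 1) → ι) j)) ^ 2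
          = (∏ j, p (f j)) * w i ^ 2 + 2 * w i * ((∏ j, p (f j)) * (∑ j, w (f j)))
            + (∏ j, p (f j)) * (∑ j, w (f j)) ^ 2 := by
        intro f
        simp only [Fin.sum_univ_succ, Fin.cons_zero, Fin.cons_succ]
        ring
      simp only [e, Finset.sum_add_distrib]
      rw [ih, ← Finset.sum_mul, prob_sum p hp k, ← Finset.mul_sum, prob_mean p hp w k, hw]
      ring
    simp only [key, mul_add, Finset.sum_add_distrib]
    rw [← Finset.sum_mul, hp]
    push_cast
    ring

theorem prob_pos_part {ι : Type} [Fintype ι] (p : ι → ℝ) (hp0 : ∀ i, 0 ≤ p i)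
    (hp : ∑ i, p i = 1) (w : ι → ℝ) (hw : ∑ i, p i * w i ≤ 0) :
    ∃ V : ℝ, ∀ k : ℕ, 0 < k →
    ∑ f : Fin k → ι, (∏ j, p (f j)) * max 0 (∑ j, w (f j)) ≤ V * √k := by
  set m := ∑ i, p i * w i with hm
  set V := ∑ i, p i * (w i - m) ^ 2 with hV
  have h0 : ∑ i, p i * (w i - m) = 0 := by
    simp only [mul_sub, Finset.sum_sub_distrib, ← Finset.sum_mul, hp]
    rw [← hm]; ring
  refine ⟨(V + 1) / 2, fun k hk => ?_⟩
  have hvar := prob_var p hp (fun i => w i - m) h0 k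
  have hs : 0 < √(k : ℝ) := Real.sqrt_pos.mpr (by exact_mod_cast hk)
  have hss : √(k : ℝ) * √(k : ℝ) = k := Real.mul_self_sqrt (by positivity)
  have hb : ∀ f : Fin k → ι, (∏ j, p (f j)) * max 0 (∑ j, w (f j)) ≤
      (1 / (2 * √k)) * ((∏ j, p (f j)) * (∑ j, (w (f j) - m)) ^ 2) + (∏ j, p (f j)) * (√k / 2) := by
    intro f
    have hpp : 0 ≤ ∏ j, p (f j) := Finset.prod_nonneg fun j _ => hp0 _
    have e : max 0 (∑ j, w (f j)) ≤ (1 / (2 * √k)) * (∑ j, (w (f j) - m)) ^ 2 + √k / 2 := by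
      have e1 : ∑ j, (w (f j) - m) = (∑ j, w (f j)) - k * m := by
        simp [Finset.sum_sub_distrib]
      set Z := ∑ j, (w (f j) - m)
      have hkm : (k : ℝ) * m ≤ 0 := mul_nonpos_of_nonneg_of_nonpos (by positivity) hw
      have e2 : max 0 (∑ j, w (f j)) ≤ |Z| := by
        apply max_le (abs_nonneg _)
        exact le_trans (by linarith) (le_abs_self Z)
      refine e2.trans ?_
      have e3 : (1 / (2 * √k)) * Z ^ 2 + √k / 2 - |Z| = (|Z| - √k) ^ 2 / (2 * √k) := by
        rw [← sq_abs Z]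
        field_simp
        ring
      have : 0 ≤ (|Z| - √k) ^ 2 / (2 * √k) := by positivity
      linarith
    calc _ ≤ (∏ j, p (f j)) * ((1 / (2 * √k)) * (∑ j, (w (f j) - m)) ^ 2 + √k / 2) :=
          mul_le_mul_of_nonneg_left e hpp
      _ = _ := by ring
  refine (Finset.sum_le_sum fun f _ => hb f).trans ?_
  rw [Finset.sum_add_distrib, ← Finset.mul_sum, ← Finset.sum_mul, prob_sum p hp k, hvar]
  apply le_of_eq
  rw [← hV]
  field_simp
  rw [Real.sq_sqrt (by positivity)]
  ring

theorem lower_bound {ι : Type} [Fintype ι] (a x y : ι → ℝ)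
    (hp : ∑ i, Real.exp (a i) = 1) (t1 t2 s q : ℝ)
    (hm : ∑ i, Real.exp (a i) * y i ≤ ∑ i, Real.exp (a i) * x i)
    (h : Tendsto (fun k : ℕ => GG a x y t1 t2 s q k ^ ((k : ℝ)⁻¹)) atTop (nhds 1)) :
    (q - 1) * (∑ i, Real.exp (a i) * a i) + t1 * (∑ i, Real.exp (a i) * x i)
      + (s - t1) * (∑ i, Real.exp (a i) * y i) ≤ 0 := by
  set p : ι → ℝ := fun i => Real.exp (a i) with hpdef
  have hp0 : ∀ i, 0 ≤ p i := fun i => (Real.exp_pos _).le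
  change (q - 1) * (∑ i, p i * a i) + t1 * (∑ i, p i * x i)
      + (s - t1) * (∑ i, p i * y i) ≤ 0
  obtain ⟨V, hV⟩ := prob_pos_part p hp0 hp (fun i => y i - x i) (by
    simp only [mul_sub, Finset.sum_sub_distrib]; linarith)
  set L := (q - 1) * (∑ i, p i * a i) + t1 * (∑ i, p i * x i)
      + (s - t1) * (∑ i, p i * y i) with hL
  have hk : ∀ k : ℕ, 0 < k → Real.exp (L - |s - t1 - t2| * V * √k / k) ≤
      GG a x y t1 t2 s q k ^ ((k : ℝ)⁻¹) := by
    intro k hk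
    have hk' : (0 : ℝ) < k := by exact_mod_cast hk
    set φ : (Fin k → ι) → ℝ := fun f => (∑ j, ((q - 1) * a (f j) + t1 * x (f j)
      + (s - t1) * y (f j))) - (s - t1 - t2) * max 0 (∑ j, (y (f j) - x (f j))) with hφ
    have hGe : GG a x y t1 t2 s q k = ∑ f : Fin k → ι, (∏ j, p (f j)) * Real.exp (φ f) := by
      unfold GG
      refine Finset.sum_congr rfl fun f _ => ?_
      have : ∏ j, p (f j) = Real.exp (∑ j, a (f j)) := by rw [Real.exp_sum]
      rw [this, ← Real.exp_add]
      congr 1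
      simp only [hφ]
      rw [lin_sum, Finset.sum_sub_distrib]
      ring
    have hJ : Real.exp (∑ f : Fin k → ι, (∏ j, p (f j)) * φ f) ≤ GG a x y t1 t2 s q k := by
      rw [hGe]
      have := convexOn_exp.map_sum_le (t := Finset.univ)
        (w := fun f : Fin k → ι => ∏ j, p (f j)) (p := φ)
        (fun f _ => Finset.prod_nonneg fun j _ => hp0 _) (prob_sum p hp k) (fun _ _ => mem_univ _)
      simpa using this
    have hE : k * L - |s - t1 - t2| * (V * √k) ≤ ∑ f : Fin k → ι, (∏ j, p (f j)) * φ f := by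
      have e1 : ∑ f : Fin k → ι, (∏ j, p (f j)) * φ f = k * L - (s - t1 - t2) *
          ∑ f : Fin k → ι, (∏ j, p (f j)) * max 0 (∑ j, (y (f j) - x (f j))) := by
        simp only [hφ, mul_sub, Finset.sum_sub_distrib]
        congr 1
        · rw [prob_mean p hp (fun i => (q - 1) * a i + t1 * x i + (s - t1) * y i) k, hL]
          simp only [Finset.mul_sum, ← Finset.sum_add_distrib]
          refine Finset.sum_congr rfl fun i _ => ?_
          ring
        · rw [Finset.mul_sum]
          refine Finset.sum_congr rfl fun f _ => ?_
          ring
      rw [e1]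
      have e2 : 0 ≤ ∑ f : Fin k → ι, (∏ j, p (f j)) * max 0 (∑ j, (y (f j) - x (f j))) :=
        Finset.sum_nonneg fun f _ =>
          mul_nonneg (Finset.prod_nonneg fun j _ => hp0 _) (le_max_left _ _)
      have e3 := mul_le_mul_of_nonneg_left (hV k hk) (abs_nonneg (s - t1 - t2))
      have e4 := mul_le_mul_of_nonneg_right (le_abs_self (s - t1 - t2)) e2
      linarith
    have h5 := (Real.exp_le_exp.mpr hE).trans hJ
    have h6 := Real.rpow_le_rpow (Real.exp_pos _).le h5 (z := (k : ℝ)⁻¹) (by positivity)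
    refine le_trans (le_of_eq ?_) h6
    rw [← Real.exp_mul]
    congr 1
    field_simp
  have hlim : Tendsto (fun k : ℕ => Real.exp (L - |s - t1 - t2| * V * √k / k)) atTop
      (nhds (Real.exp (L - |s - t1 - t2| * V * 0))) := by
    refine (Real.continuous_exp.tendsto _).comp ?_
    refine Tendsto.sub tendsto_const_nhds ?_
    simp only [mul_div_assoc]
    refine Tendsto.const_mul _ ?_
    simp only [Real.sqrt_div_self']
    have : Tendsto (fun k : ℕ => √(k : ℝ)) atTop atTop :=
      Real.tendsto_sqrt_atTop.comp tendsto_natCast_atTop_atTop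
    have h7 := this.inv_tendsto_atTop
    refine h7.congr fun k => ?_
    simp
  have := le_of_tendsto_of_tendsto hlim h (by
    filter_upwards [eventually_gt_atTop 0] with k hk0 using hk k hk0)
  rw [mul_zero, sub_zero] at this
  exact Real.exp_le_one_iff.mp this

theorem hasDerivAt_of_eps {f : ℝ → ℝ} {A : ℝ} (h1 : f 1 = 0)
    (h : ∀ ε > 0, ∀ᶠ q in nhds (1 : ℝ), |f q - A * (q - 1)| ≤ ε * |q - 1|) :
    HasDerivAt f A 1 := by
  rw [hasDerivAt_iff_isLittleO, Asymptotics.isLittleO_iff]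
  intro ε hε
  filter_upwards [h ε hε] with q hq
  simpa [h1, mul_comm] using hq

theorem eps_of_hasDerivAt {f : ℝ → ℝ} {A : ℝ} (h : HasDerivAt f A 1) :
    ∀ ε > 0, ∀ᶠ q in nhds (1 : ℝ), |f q - f 1 - A * (q - 1)| ≤ ε * |q - 1| := by
  rw [hasDerivAt_iff_isLittleO, Asymptotics.isLittleO_iff] at h
  intro ε hε
  filter_upwards [h hε] with q hq
  simpa [mul_comm] using hq

theorem implicit_zero {ι : Type} [Fintype ι] [Nonempty ι] (a y : ι → ℝ)
    (hp : ∑ i, Real.exp (a i) = 1) (hy : ∀ i, y i < 0) (s : ℝ)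
    (h : ∑ i, Real.exp (a i + s * y i) = 1) : s = 0 := by
  have h0 : ∑ i, Real.exp (a i + 0 * y i) = 1 := by simpa using hp
  rcases lt_trichotomy s 0 with hs | hs | hs
  · have := sum_exp_anti a y hy hs; linarith
  · exact hs
  · have := sum_exp_anti a y hy hs; linarith

theorem implicit_deriv {ι : Type} [Fintype ι] [Nonempty ι] (a x y : ι → ℝ)
    (hp : ∑ i, Real.exp (a i) = 1) (hy : ∀ i, y i < 0) (τ g : ℝ → ℝ) (D A : ℝ)
    (hτ0 : τ 1 = 0) (hτ : HasDerivAt τ D 1)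
    (hg : ∀ q, 0 ≤ q → ∑ i, Real.exp (q * a i + τ q * x i + (g q - τ q) * y i) = 1)
    (hA : (∑ i, Real.exp (a i) * a i) + D * (∑ i, Real.exp (a i) * x i)
      + (A - D) * (∑ i, Real.exp (a i) * y i) = 0) :
    g 1 = 0 ∧ HasDerivAt g A 1 := by
  have hg1 : g 1 = 0 := by
    apply implicit_zero a y hp hy
    simpa [hτ0] using hg 1 zero_le_one
  refine ⟨hg1, hasDerivAt_of_eps hg1 ?_⟩
  have hmY : ∑ i, Real.exp (a i) * y i < 0 :=
    Finset.sum_neg (fun i _ => mul_neg_of_pos_of_neg (Real.exp_pos _) (hy i))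
      Finset.univ_nonempty
  have key : ∀ e : ℝ, e ≠ 0 → ∀ᶠ q in nhds (1 : ℝ),
      (0 < e * (q - 1) → g q ≤ (A + e) * (q - 1)) ∧
      (e * (q - 1) < 0 → (A + e) * (q - 1) ≤ g q) := by
    intro e he
    set H : ℝ → ℝ := fun q => ∑ i, Real.exp (q * a i + τ q * x i + ((A + e) * (q - 1) - τ q) * y i)
      with hH
    have hH1 : H 1 = 1 := by simp [hH, hτ0, hp]
    have hHd : HasDerivAt H (e * ∑ i, Real.exp (a i) * y i) 1 := by
      have hd : HasDerivAt H (∑ i, Real.exp (1 * a i + τ 1 * x i + ((A + e) * (1 - 1) - τ 1) * y i)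
          * (1 * a i + D * x i + ((A + e) * 1 - D) * y i)) 1 := by
        apply HasDerivAt.fun_sum
        intro i _
        apply HasDerivAt.exp
        refine ((hasDerivAt_id' (1 : ℝ)).mul_const (a i) |>.add (hτ.mul_const (x i))).add ?_
        refine HasDerivAt.mul_const ?_ (y i)
        exact (((hasDerivAt_id' (1 : ℝ)).sub_const 1).const_mul (A + e)).sub hτ
      convert hd using 1
      simp only [hτ0, one_mul, zero_mul, sub_self, mul_zero, add_zero, mul_one]
      have e1 : ∀ i, Real.exp (a i) * (a i + D * x i + (A + e - D) * y i) =
        Real.exp (a i) * a i + D * (Real.exp (a i) * x i) + (A - D) * (Real.exp (a i) * y i)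
          + e * (Real.exp (a i) * y i) := fun i => by ring
      simp only [e1, Finset.sum_add_distrib, ← Finset.mul_sum]
      linarith
    have := eps_of_hasDerivAt hHd (|e * ∑ i, Real.exp (a i) * y i| / 2)
      (by have := abs_pos.mpr (mul_ne_zero he hmY.ne); linarith)
    filter_upwards [this, Ioi_mem_nhds (zero_lt_one' ℝ)] with q hq hq0
    set M := ∑ i, Real.exp (a i) * y i
    rw [hH1, div_mul_eq_mul_div, ← abs_mul] at hq
    have hgq := hg q (le_of_lt hq0)
    constructor
    · intro hpos
      by_contra hcon
      push Not at hcon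
      have h1 := sum_exp_anti (fun i => q * a i + τ q * x i) y hy (s := (A + e) * (q - 1) - τ q)
        (s' := g q - τ q) (by linarith)
      have h2 : 1 < H q := by rw [← hgq]; exact h1
      have h3 : e * M * (q - 1) < 0 := by nlinarith
      rw [abs_of_neg h3] at hq
      have := (abs_le.mp hq).2
      linarith
    · intro hneg
      by_contra hcon
      push Not at hcon
      have h1 := sum_exp_anti (fun i => q * a i + τ q * x i) y hy (s' := (A + e) * (q - 1) - τ q)
        (s := g q - τ q) (by linarith)
      have h2 : H q < 1 := by rw [← hgq]; exact h1
      have h3 : 0 < e * M * (q - 1) := by nlinarith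
      rw [abs_of_pos h3] at hq
      have := (abs_le.mp hq).1
      linarith
  intro ε hε
  filter_upwards [key ε hε.ne', key (-ε) (neg_ne_zero.mpr hε.ne')] with q h1 h2
  rcases lt_trichotomy q 1 with hq | hq | hq
  · have k1 := h1.2 (by nlinarith)
    have k2 := h2.1 (by nlinarith)
    rw [abs_of_neg (sub_neg.mpr hq), abs_le]
    constructor <;> nlinarith
  · subst hq; simp [hg1]
  · have k1 := h1.1 (by nlinarith)
    have k2 := h2.2 (by nlinarith)
    rw [abs_of_pos (sub_pos.mpr hq), abs_le]
    constructor <;> nlinarith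

theorem max_min_lin {A B C mX mY : ℝ} (hmX : mX < 0) (hm : mY ≤ mX)
    (h : (A - C) * mY = (B - C) * mX) (t : ℝ) :
    max (A * t) (min (B * t) (C * t)) = A * t := by
  apply max_eq_left
  have h' : (A * t - C * t) * mY = (B * t - C * t) * mX := by linear_combination t * h
  by_contra hcon
  push Not at hcon
  obtain ⟨h1, h2⟩ := lt_min_iff.mp hcon
  nlinarith

theorem core {ι : Type} [Fintype ι] [Nonempty ι] (a x y : ι → ℝ)
    (hp : ∑ i, Real.exp (a i) = 1) (hx : ∀ i, x i < 0) (hy : ∀ i, y i < 0)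
    (τ1 τ2 γ gA gB : ℝ → ℝ) (D1 D2 A B : ℝ)
    (hτ10 : τ1 1 = 0) (hτ1 : HasDerivAt τ1 D1 1)
    (hτ20 : τ2 1 = 0) (hτ2 : HasDerivAt τ2 D2 1)
    (hgA : ∀ q, 0 ≤ q → ∑ i, Real.exp (q * a i + τ1 q * x i + (gA q - τ1 q) * y i) = 1)
    (hgB : ∀ q, 0 ≤ q → ∑ i, Real.exp (q * a i + τ2 q * y i + (gB q - τ2 q) * x i) = 1)
    (hA : (∑ i, Real.exp (a i) * a i) + D1 * (∑ i, Real.exp (a i) * x i)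
      + (A - D1) * (∑ i, Real.exp (a i) * y i) = 0)
    (hB : (∑ i, Real.exp (a i) * a i) + D2 * (∑ i, Real.exp (a i) * y i)
      + (B - D2) * (∑ i, Real.exp (a i) * x i) = 0)
    (hm : ∑ i, Real.exp (a i) * y i ≤ ∑ i, Real.exp (a i) * x i)
    (hG : ∀ q, 0 ≤ q → Tendsto (fun k : ℕ => GG a x y (τ1 q) (τ2 q) (γ q) q k ^ ((k : ℝ)⁻¹))
      atTop (nhds 1)) :
    HasDerivAt γ A 1 := by
  obtain ⟨hA0, hAd⟩ := implicit_deriv a x y hp hy τ1 gA D1 A hτ10 hτ1 hgA hA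
  obtain ⟨hB0, hBd⟩ := implicit_deriv a y x hp hx τ2 gB D2 B hτ20 hτ2 hgB hB
  have hup : ∀ q, 0 ≤ q → γ q ≤ max (gA q) (min (gB q) (τ1 q + τ2 q)) := fun q hq =>
    upper_bound a x y hx hy _ _ _ q _ _ (hgA q hq) (hgB q hq) (hG q hq)
  have hlo := fun q (hq : (0 : ℝ) ≤ q) =>
    lower_bound a x y hp (τ1 q) (τ2 q) (γ q) q hm (hG q hq)
  have hmY : ∑ i, Real.exp (a i) * y i < 0 :=
    Finset.sum_neg (fun i _ => mul_neg_of_pos_of_neg (Real.exp_pos _) (hy i))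
      Finset.univ_nonempty
  have hmX : ∑ i, Real.exp (a i) * x i < 0 :=
    Finset.sum_neg (fun i _ => mul_neg_of_pos_of_neg (Real.exp_pos _) (hx i))
      Finset.univ_nonempty
  set h := ∑ i, Real.exp (a i) * a i
  set mX := ∑ i, Real.exp (a i) * x i
  set mY := ∑ i, Real.exp (a i) * y i
  set l : ℝ → ℝ := fun q => τ1 q - ((q - 1) * h + τ1 q * mX) / mY with hl
  have hl1 : l 1 = 0 := by simp [hl, hτ10]
  have hld : HasDerivAt l A 1 := by
    have hd : HasDerivAt l (D1 - (1 * h + D1 * mX) / mY) 1 :=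
      hτ1.sub (((((hasDerivAt_id' (1 : ℝ)).sub_const 1).mul_const h).add
        (hτ1.mul_const mX)).div_const mY)
    convert hd using 1
    field_simp [hmY.ne]
    linarith
  have hlo' : ∀ q, 0 ≤ q → l q ≤ γ q := by
    intro q hq
    have h1 := hlo q hq
    have h2 : (l q - τ1 q) * mY = -((q - 1) * h + τ1 q * mX) := by
      simp only [hl]; field_simp [hmY.ne]; ring
    by_contra hcon
    push Not at hcon
    nlinarith
  have hγ1 : γ 1 = 0 := by
    have h1 := hlo' 1 zero_le_one
    have h2 := hup 1 zero_le_one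
    simp [hA0, hB0, hτ10, hτ20] at h2
    linarith
  have hCd : HasDerivAt (fun q => τ1 q + τ2 q) (D1 + D2) 1 := hτ1.add hτ2
  refine hasDerivAt_of_eps hγ1 fun ε hε => ?_
  filter_upwards [eps_of_hasDerivAt hld ε hε, eps_of_hasDerivAt hAd ε hε,
    eps_of_hasDerivAt hBd ε hε, eps_of_hasDerivAt hCd ε hε,
    Ioi_mem_nhds (zero_lt_one' ℝ)] with q e1 e2 e3 e4 hq0
  rw [hl1, sub_zero] at e1
  rw [hA0, sub_zero] at e2
  rw [hB0, sub_zero] at e3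
  rw [hτ10, hτ20, add_zero, sub_zero] at e4
  have hq0' : (0 : ℝ) ≤ q := le_of_lt hq0
  have k1 := hlo' q hq0'
  have k2 := hup q hq0'
  have k3 := max_min_lin (A := A) (B := B) (C := D1 + D2) hmX hm
    (by linarith) (q - 1)
  rw [abs_le] at *
  constructor
  · linarith
  · have : max (gA q) (min (gB q) (τ1 q + τ2 q)) ≤
        max (A * (q - 1)) (min (B * (q - 1)) ((D1 + D2) * (q - 1))) + ε * |q - 1| := by
      rw [max_add_add_right (A * (q - 1)) _ _ |>.symm, ← min_add_add_right]
      refine max_le_max (by linarith) (min_le_min (by linarith) (by linarith))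
    linarith

theorem lqspec_one (ν : Measure ℝ) [IsProbabilityMeasure ν] (t : ℝ) (h : IsLqSpec ν 1 t) :
    t = 0 := by
  have := h.1
  unfold lowerLq at this
  simpa using this.symm

theorem dims_sep {ι : Type} (B : IFSData ι) (hsep : ∀ i, B.swap i = false) (l : List ι) :
    B.dims l = ((l.map B.c).prod, (l.map B.d).prod) := by
  induction l with
  | nil => rfl
  | cons i l ih =>
    have : B.dims (i :: l) = (B.c i * (if B.swap i then (B.dims l).2 else (B.dims l).1),
      B.d i * (if B.swap i then (B.dims l).1 else (B.dims l).2)) := rfl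
    rw [this, ih]
    simp [hsep]

theorem swapW_sep {ι : Type} (B : IFSData ι) (hsep : ∀ i, B.swap i = false) (l : List ι) :
    B.swapW l = false := by
  induction l with
  | nil => rfl
  | cons i l ih =>
    have : B.swapW (i :: l) = xor (B.swap i) (B.swapW l) := rfl
    rw [this, ih, hsep]; rfl

theorem prod_eq_exp {ι : Type} (w : ι → ℝ) (hw : ∀ i, 0 < w i) (k : ℕ) (f : Fin k → ι) :
    ((List.ofFn f).map w).prod = Real.exp (∑ j, Real.log (w (f j))) := by
  rw [List.map_ofFn, List.prod_ofFn, Real.exp_sum]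
  refine Finset.prod_congr rfl fun j _ => ?_
  rw [Real.exp_log (hw _)]; rfl

theorem PsiSV_eq {ι : Type} [Fintype ι] (B : IFSData ι) (hc : ∀ i, 0 < B.c i)
    (hd : ∀ i, 0 < B.d i) (p : ι → ℝ) (hp : ∀ i, 0 < p i) (hsep : ∀ i, B.swap i = false)
    (τ1 τ2 : ℝ → ℝ) (k : ℕ) (s q : ℝ) :
    PsiSV B p τ1 τ2 k s q = GG (fun i => Real.log (p i)) (fun i => Real.log (B.c i))
      (fun i => Real.log (B.d i)) (τ1 q) (τ2 q) s q k := by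
  unfold PsiSV GG
  refine Finset.sum_congr rfl fun f _ => ?_
  unfold psiSV tauW IFSData.usesPi1 IFSData.alpha1 IFSData.alpha2 wordProb
  rw [dims_sep B hsep, swapW_sep B hsep]
  simp only [prod_eq_exp _ hc, prod_eq_exp _ hd, prod_eq_exp _ hp]
  set X := ∑ j, Real.log (B.c (f j))
  set Y := ∑ j, Real.log (B.d (f j))
  by_cases h : Y ≤ X
  · have h' := Real.exp_le_exp.mpr h
    simp only [h', and_self, true_or, if_true, max_eq_left h', min_eq_right h',
      max_eq_left (sub_nonpos.mpr h), ← Real.exp_mul, ← Real.exp_add]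
    congr 1; ring
  · have h1 := (not_le.mp h).le
    have h' := Real.exp_le_exp.mpr h1
    have h2 : ¬ Real.exp Y ≤ Real.exp X := fun hh => h (Real.exp_le_exp.mp hh)
    simp only [h2, and_false, false_or, Bool.false_eq_true, false_and, if_false,
      max_eq_right h', min_eq_left h',
      max_eq_right (sub_nonneg.mpr h1), ← Real.exp_mul, ← Real.exp_add]
    congr 1; ring

theorem gamma_differentiable_at_one_separated_type
    {ι : Type} [Fintype ι] [Nonempty ι] (hcard : 2 ≤ Fintype.card ι)
    (B : IFSData ι)
    (hc : ∀ i, B.c i ∈ Set.Ioo (0 : ℝ) 1) (hd : ∀ i, B.d i ∈ Set.Ioo (0 : ℝ) 1)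
    (p : ι → ℝ) (hp : ∀ i, p i ∈ Set.Ioo (0 : ℝ) 1) (hpsum : ∑ i : ι, p i = 1)
    (μ : Measure (ℝ × ℝ)) [IsProbabilityMeasure μ]
    (hcpt : ∃ K : Set (ℝ × ℝ), IsCompact K ∧ μ Kᶜ = 0)
    (hself : μ = ∑ i : ι, ENNReal.ofReal (p i) • Measure.map (B.S i) μ)
    (τ1 τ2 : ℝ → ℝ)
    (hτ1 : ∀ q : ℝ, 0 ≤ q → IsLqSpec (Measure.map Prod.fst μ) q (τ1 q))
    (hτ2 : ∀ q : ℝ, 0 ≤ q → IsLqSpec (Measure.map Prod.snd μ) q (τ2 q))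
    (P : ℝ → ℝ → ℝ)
    (hP : ∀ s q : ℝ, 0 ≤ q →
      Tendsto (fun k : ℕ => PsiSV B p τ1 τ2 k s q ^ ((k : ℝ)⁻¹)) atTop (nhds (P s q)))
    (γ : ℝ → ℝ) (hγ : ∀ q : ℝ, 0 ≤ q → P (γ q) q = 1)
    (hsep : ∀ i, B.swap i = false)
    (γA γB : ℝ → ℝ)
    (hγA : ∀ q : ℝ, 0 ≤ q → ∑ i : ι, p i ^ q * B.c i ^ τ1 q * B.d i ^ (γA q - τ1 q) = 1)
    (hγB : ∀ q : ℝ, 0 ≤ q → ∑ i : ι, p i ^ q * B.d i ^ τ2 q * B.c i ^ (γB q - τ2 q) = 1)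
     :
    ∀ D1 D2 : ℝ, HasDerivAt τ1 D1 1 → HasDerivAt τ2 D2 1 →
      ∃ DA DB Dγ : ℝ, HasDerivAt γA DA 1 ∧ HasDerivAt γB DB 1 ∧ HasDerivAt γ Dγ 1 ∧
        (D1 + D2 ≤ min DA DB → Dγ = min DA DB) ∧
        (max DA DB ≤ D1 + D2 → Dγ = max DA DB) := by
  intro D1 D2 hD1 hD2
  have : IsProbabilityMeasure (Measure.map Prod.fst μ) :=
    Measure.isProbabilityMeasure_map measurable_fst.aemeasurable
  have : IsProbabilityMeasure (Measure.map Prod.snd μ) :=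
    Measure.isProbabilityMeasure_map measurable_snd.aemeasurable
  have hτ10 : τ1 1 = 0 := lqspec_one _ _ (hτ1 1 zero_le_one)
  have hτ20 : τ2 1 = 0 := lqspec_one _ _ (hτ2 1 zero_le_one)
  set a : ι → ℝ := fun i => Real.log (p i) with ha
  set x : ι → ℝ := fun i => Real.log (B.c i) with hxdef
  set y : ι → ℝ := fun i => Real.log (B.d i) with hydef
  have hx : ∀ i, x i < 0 := fun i => Real.log_neg (hc i).1 (hc i).2
  have hy : ∀ i, y i < 0 := fun i => Real.log_neg (hd i).1 (hd i).2
  have hpe : ∑ i, Real.exp (a i) = 1 := by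
    rw [← hpsum]
    exact Finset.sum_congr rfl fun i _ => Real.exp_log (hp i).1
  have hgA : ∀ q, 0 ≤ q → ∑ i, Real.exp (q * a i + τ1 q * x i + (γA q - τ1 q) * y i) = 1 := by
    intro q hq
    rw [← hγA q hq]
    refine Finset.sum_congr rfl fun i _ => ?_
    rw [Real.rpow_def_of_pos (hp i).1, Real.rpow_def_of_pos (hc i).1,
      Real.rpow_def_of_pos (hd i).1, ← Real.exp_add, ← Real.exp_add]
    congr 1; simp only [ha, hxdef, hydef]; ring
  have hgB : ∀ q, 0 ≤ q → ∑ i, Real.exp (q * a i + τ2 q * y i + (γB q - τ2 q) * x i) = 1 := by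
    intro q hq
    rw [← hγB q hq]
    refine Finset.sum_congr rfl fun i _ => ?_
    rw [Real.rpow_def_of_pos (hp i).1, Real.rpow_def_of_pos (hc i).1,
      Real.rpow_def_of_pos (hd i).1, ← Real.exp_add, ← Real.exp_add]
    congr 1; simp only [ha, hxdef, hydef]; ring
  have hG : ∀ q, 0 ≤ q → Tendsto
      (fun k : ℕ => GG a x y (τ1 q) (τ2 q) (γ q) q k ^ ((k : ℝ)⁻¹)) atTop (nhds 1) := by
    intro q hq
    have h := hP (γ q) q hq
    rw [hγ q hq] at h
    refine h.congr fun k => ?_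
    rw [PsiSV_eq B (fun i => (hc i).1) (fun i => (hd i).1) p (fun i => (hp i).1) hsep]
  have hG' : ∀ q, 0 ≤ q → Tendsto
      (fun k : ℕ => GG a y x (τ2 q) (τ1 q) (γ q) q k ^ ((k : ℝ)⁻¹)) atTop (nhds 1) := by
    intro q hq
    refine (hG q hq).congr fun k => ?_
    rw [GG_symm]
  have hmY : ∑ i, Real.exp (a i) * y i < 0 :=
    Finset.sum_neg (fun i _ => mul_neg_of_pos_of_neg (Real.exp_pos _) (hy i))
      Finset.univ_nonempty
  have hmX : ∑ i, Real.exp (a i) * x i < 0 :=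
    Finset.sum_neg (fun i _ => mul_neg_of_pos_of_neg (Real.exp_pos _) (hx i))
      Finset.univ_nonempty
  obtain ⟨h, hh⟩ : ∃ h, h = ∑ i, Real.exp (a i) * a i := ⟨_, rfl⟩
  obtain ⟨mX, hmXe⟩ : ∃ h, h = ∑ i, Real.exp (a i) * x i := ⟨_, rfl⟩
  obtain ⟨mY, hmYe⟩ : ∃ h, h = ∑ i, Real.exp (a i) * y i := ⟨_, rfl⟩
  rw [← hmXe] at hmX
  rw [← hmYe] at hmY
  obtain ⟨DA, hA⟩ : ∃ DA, h + D1 * mX + (DA - D1) * mY = 0 :=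
    ⟨D1 - (h + D1 * mX) / mY, by field_simp [hmY.ne]; ring⟩
  obtain ⟨DB, hB⟩ : ∃ DB, h + D2 * mY + (DB - D2) * mX = 0 :=
    ⟨D2 - (h + D2 * mY) / mX, by field_simp [hmX.ne]; ring⟩
  have hrel : (DA - (D1 + D2)) * mY = (DB - (D1 + D2)) * mX := by linarith
  have hA' := hA
  have hB' := hB
  rw [hh, hmXe, hmYe] at hA' hB'
  have dA := (implicit_deriv a x y hpe hy τ1 γA D1 DA hτ10 hD1 hgA hA').2
  have dB := (implicit_deriv a y x hpe hx τ2 γB D2 DB hτ20 hD2 hgB hB').2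
  rcases le_total mY mX with hm | hm
  · refine ⟨DA, DB, DA, dA, dB, ?_, fun hle => ?_, fun hle => ?_⟩
    · rw [hmXe, hmYe] at hm
      exact core a x y hpe hx hy τ1 τ2 γ γA γB D1 D2 DA DB hτ10 hD1 hτ20 hD2 hgA hgB hA' hB' hm hG
    · obtain ⟨h1, h2⟩ := le_min_iff.mp hle
      symm; apply min_eq_left
      by_contra hcon
      push Not at hcon
      nlinarith
    · obtain ⟨h1, h2⟩ := max_le_iff.mp hle
      symm; apply max_eq_left
      by_contra hcon
      push Not at hcon
      nlinarith
  · refine ⟨DA, DB, DB, dA, dB, ?_, fun hle => ?_, fun hle => ?_⟩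
    · rw [hmXe, hmYe] at hm
      exact core a y x hpe hy hx τ2 τ1 γ γB γA D2 D1 DB DA hτ20 hD2 hτ10 hD1 hgB hgA hB' hA' hm hG'
    · obtain ⟨h1, h2⟩ := le_min_iff.mp hle
      symm; apply min_eq_right
      by_contra hcon
      push Not at hcon
      nlinarith
    · obtain ⟨h1, h2⟩ := max_le_iff.mp hle
      symm; apply max_eq_right
      by_contra hcon
      push Not at hcon
      nlinarith
end
end

section
/- Fix q > 0 at which τ_1 and τ_2 are differentiable, and let s ∈ ℝ, i, j ∈ I^* (with ij denoting concatenation) and k, l ∈ ℕ. Then: (1) if s ≤ τ_1'(q)+τ_2'(q), then ψ̂^{s,q}(ij) ≤ ψ̂^{s,q}(i)·ψ̂^{s,q}(j); (2) if s ≥ τ_1'(q)+τ_2'(q), then ψ̂^{s,q}(ij) ≥ ψ̂^{s,q}(i)·ψ̂^{s,q}(j); (3) if γ(q) = τ_1(q)+τ_2(q) and s ≤ τ_1'(q)+τ_2'(q), then Ψ̂_{k+l}^{s,q} ≤ Ψ̂_k^{s,q} + Ψ̂_l^{s,q}; (4) if γ(q) = τ_1(q)+τ_2(q) and s ≥ τ_1'(q)+τ_2'(q),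 then Ψ̂_{k+l}^{s,q} ≥ Ψ̂_k^{s,q} + Ψ̂_l^{s,q}. -/
open MeasureTheory Filter Set

attribute [local instance] Classical.propDecidable

noncomputable section

/-- `τ_i'(q)`: the derivative of the selected projection spectrum. -/
def tauWD {ι : Type} (B : IFSData ι) (D1 D2 : ℝ) (l : List ι) : ℝ :=
  if B.usesPi1 l then D1 else D2

/-- The alternative singular value function `ψ̂^{s,q}`. -/
def psiHat {ι : Type} (B : IFSData ι) (p : ι → ℝ) (D1 D2 : ℝ) (s : ℝ) (l : List ι) : ℝ :=
  wordProb p l * B.alpha1 l ^ tauWD B D1 D2 l * B.alpha2 l ^ (s - tauWD B D1 D2 l)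

/-- `Ψ̂_k^{s,q} = ∑_{i ∈ I^k} ψ^{γ_k(q),q}(i) · log ψ̂^{s,q}(i)`. -/
def PsiHat {ι : Type} [Fintype ι] (B : IFSData ι) (p : ι → ℝ) (τ1 τ2 : ℝ → ℝ)
    (γks : ℕ → ℝ → ℝ) (D1 D2 : ℝ) (k : ℕ) (s q : ℝ) : ℝ :=
  ∑ f : Fin k → ι, psiSV B p τ1 τ2 (γks k q) q (List.ofFn f) *
    Real.log (psiHat B p D1 D2 s (List.ofFn f))

/-! ### Part A: grid comparison for `L^q`-spectra on the line -/

/-- The mass of the grid cell `n` at scale `δ`. -/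
def cellMass (ν : Measure ℝ) (δ : ℝ) (n : ℤ) : ℝ := ν.real ((fun x : ℝ => ⌊x / δ⌋) ⁻¹' {n})

/-- The `L^q` integral. -/
def lqInt (ν : Measure ℝ) (q δ : ℝ) : ℝ :=
  ∫ x, (ν (Metric.ball x δ)).toReal ^ (q - 1) ∂ν

lemma cm_nonneg (ν : Measure ℝ) (δ : ℝ) (n : ℤ) : 0 ≤ cellMass ν δ n := measureReal_nonneg

lemma cm_le_one (ν : Measure ℝ) [IsProbabilityMeasure ν] (δ : ℝ) (n : ℤ) :
    cellMass ν δ n ≤ 1 := measureReal_le_one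

lemma meas_floor (δ : ℝ) : Measurable (fun x : ℝ => ⌊x / δ⌋) :=
  Int.measurable_floor.comp (measurable_id.div_const δ)

lemma meas_ball (ν : Measure ℝ) [IsProbabilityMeasure ν] (q δ : ℝ) :
    Measurable (fun x : ℝ => (ν (Metric.ball x δ)).toReal ^ (q - 1)) := by
  have h : MeasurableSet {z : ℝ × ℝ | dist z.2 z.1 < δ} :=
    (isOpen_lt (continuous_snd.dist continuous_fst) continuous_const).measurableSet
  have h2 := measurable_measure_prodMk_left (ν := ν) h
  exact (h2.ennreal_toReal).pow_const (q - 1)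

lemma cell_le_ball (ν : Measure ℝ) [IsProbabilityMeasure ν] {δ : ℝ} (hδ : 0 < δ) (x : ℝ) :
    cellMass ν δ ⌊x / δ⌋ ≤ (ν (Metric.ball x δ)).toReal := by
  apply measureReal_mono _ (measure_ne_top _ _)
  intro y hy
  simp only [mem_preimage, mem_singleton_iff] at hy
  rw [Metric.mem_ball, Real.dist_eq]
  have h := Int.abs_sub_lt_one_of_floor_eq_floor hy
  rw [← sub_div, abs_div, abs_of_pos hδ, div_lt_one hδ] at h
  exact h

lemma ball_le_cells (ν : Measure ℝ) [IsProbabilityMeasure ν] {δ : ℝ} (hδ : 0 < δ) (x : ℝ) :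
    (ν (Metric.ball x δ)).toReal ≤ cellMass ν δ (⌊x / δ⌋ - 1) + cellMass ν δ ⌊x / δ⌋
      + cellMass ν δ (⌊x / δ⌋ + 1) := by
  set f : ℝ → ℤ := fun x : ℝ => ⌊x / δ⌋ with hf
  have hsub : Metric.ball x δ ⊆ (f ⁻¹' {f x - 1} ∪ f ⁻¹' {f x}) ∪ f ⁻¹' {f x + 1} := by
    intro y hy
    rw [Metric.mem_ball, Real.dist_eq] at hy
    have h : |y / δ - x / δ| < 1 := by
      rw [← sub_div, abs_div, abs_of_pos hδ, div_lt_one hδ]; exact hy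
    rw [abs_lt] at h
    have h1 : f y < f x + 2 := by
      rw [Int.floor_lt]; push_cast
      have := Int.lt_floor_add_one (x / δ)
      simp only [hf]; linarith
    have h2 : f x - 1 ≤ f y := by
      rw [Int.le_floor]; push_cast
      have := Int.floor_le (x / δ)
      simp only [hf]; linarith
    simp only [mem_union, mem_preimage, mem_singleton_iff]
    omega
  calc ν.real (Metric.ball x δ) ≤ ν.real ((f ⁻¹' {f x - 1} ∪ f ⁻¹' {f x}) ∪ f ⁻¹' {f x + 1}) :=
        measureReal_mono hsub (measure_ne_top _ _)
    _ ≤ ν.real (f ⁻¹' {f x - 1} ∪ f ⁻¹' {f x}) + ν.real (f ⁻¹' {f x + 1}) :=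
        measureReal_union_le _ _
    _ ≤ _ := by
        have := measureReal_union_le (μ := ν) (f ⁻¹' {f x - 1}) (f ⁻¹' {f x})
        unfold cellMass
        linarith

lemma ae_cell_pos (ν : Measure ℝ) [IsProbabilityMeasure ν] (δ : ℝ) :
    ∀ᵐ x ∂ν, 0 < cellMass ν δ ⌊x / δ⌋ := by
  apply ae_of_ae_map (f := fun x : ℝ => ⌊x / δ⌋) (p := fun n => 0 < cellMass ν δ n)
    (meas_floor δ).aemeasurable
  rw [ae_iff_of_countable]
  intro n hn
  rw [Measure.map_apply (meas_floor δ) (measurableSet_singleton n)] at hn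
  exact ENNReal.toReal_pos hn (measure_ne_top _ _)

/-- The finite set of relevant cells. -/
def gridF (R δ : ℝ) : Finset ℤ := Finset.Icc ⌊-R / δ⌋ ⌊R / δ⌋

lemma cell_zero (ν : Measure ℝ) [IsProbabilityMeasure ν] {R δ : ℝ} (hδ : 0 < δ)
    (hR : ν (Icc (-R) R)ᶜ = 0) (n : ℤ) (hn : n ∉ gridF R δ) : cellMass ν δ n = 0 := by
  have : ν ((fun x : ℝ => ⌊x / δ⌋) ⁻¹' {n}) = 0 := by
    apply measure_mono_null _ hR
    intro x hx hx2
    simp only [mem_preimage, mem_singleton_iff] at hx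
    apply hn
    rw [gridF, Finset.mem_Icc, ← hx]
    exact ⟨Int.floor_mono (by gcongr; exact hx2.1), Int.floor_mono (by gcongr; exact hx2.2)⟩
  simp [cellMass, Measure.real, this]

lemma grid_integrable (ν : Measure ℝ) [IsProbabilityMeasure ν] {R δ : ℝ} (hδ : 0 < δ)
    (hR : ν (Icc (-R) R)ᶜ = 0) (φ : ℤ → ℝ) : Integrable (fun x => φ ⌊x / δ⌋) ν := by
  apply Integrable.of_bound (C := ∑ n ∈ gridF R δ, |φ n|)
  · exact ((measurable_of_countable φ).comp (meas_floor δ)).aestronglyMeasurable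
  · filter_upwards [ae_cell_pos ν δ] with x hx
    have : ⌊x / δ⌋ ∈ gridF R δ := by
      by_contra h
      rw [cell_zero ν hδ hR _ h] at hx
      exact lt_irrefl _ hx
    exact Finset.single_le_sum (f := fun n => |φ n|) (fun n _ => abs_nonneg _) this

lemma grid_integral (ν : Measure ℝ) [IsProbabilityMeasure ν] {R δ : ℝ} (hδ : 0 < δ)
    (hR : ν (Icc (-R) R)ᶜ = 0) (φ : ℤ → ℝ) :
    ∫ x, φ ⌊x / δ⌋ ∂ν = ∑ n ∈ gridF R δ, cellMass ν δ n * φ n := by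
  have hm : AEStronglyMeasurable φ (Measure.map (fun x : ℝ => ⌊x / δ⌋) ν) :=
    (measurable_of_countable φ).aestronglyMeasurable
  have hi : Integrable φ (Measure.map (fun x : ℝ => ⌊x / δ⌋) ν) :=
    (integrable_map_measure hm (meas_floor δ).aemeasurable).2 (grid_integrable ν hδ hR φ)
  rw [← integral_map (φ := fun x : ℝ => ⌊x / δ⌋) (meas_floor δ).aemeasurable hm,
    integral_countable hi]
  have h1 : ∀ n : ℤ, (Measure.map (fun x : ℝ => ⌊x / δ⌋) ν).real {n} = cellMass ν δ n := by
    intro n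
    rw [map_measureReal_apply (meas_floor δ) (measurableSet_singleton n)]
    rfl
  simp only [h1, smul_eq_mul]
  apply tsum_eq_sum
  intro n hn
  rw [cell_zero ν hδ hR n hn, zero_mul]

lemma cells_sum (ν : Measure ℝ) [IsProbabilityMeasure ν] {R δ : ℝ} (hδ : 0 < δ)
    (hR : ν (Icc (-R) R)ᶜ = 0) : ∑ n ∈ gridF R δ, cellMass ν δ n = 1 := by
  have := grid_integral ν hδ hR (fun _ => 1)
  simpa using this.symm

lemma mul_rpow_sub_one {a q : ℝ} (ha : 0 ≤ a) (hq : 0 < q) : a * a ^ (q - 1) = a ^ q := by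
  rcases ha.eq_or_lt with h | h
  · rw [← h, zero_mul, Real.zero_rpow hq.ne']
  · rw [Real.rpow_sub_one h.ne']; field_simp

lemma ball_integrable (ν : Measure ℝ) [IsProbabilityMeasure ν] {R δ q : ℝ} (hδ : 0 < δ)
    (hR : ν (Icc (-R) R)ᶜ = 0) :
    Integrable (fun x : ℝ => (ν (Metric.ball x δ)).toReal ^ (q - 1)) ν := by
  rcases le_total 1 q with h | h
  · apply Integrable.of_bound (C := 1) (meas_ball ν q δ).aestronglyMeasurable
    refine Eventually.of_forall fun x => ?_
    rw [Real.norm_eq_abs, abs_of_nonneg (by positivity)]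
    exact Real.rpow_le_one ENNReal.toReal_nonneg measureReal_le_one (by linarith)
  · apply Integrable.mono' (grid_integrable ν hδ hR (fun n => cellMass ν δ n ^ (q - 1)))
      (meas_ball ν q δ).aestronglyMeasurable
    filter_upwards [ae_cell_pos ν δ] with x hx
    rw [Real.norm_eq_abs, abs_of_nonneg (by positivity)]
    exact Real.rpow_le_rpow_of_nonpos hx (cell_le_ball ν hδ x) (by linarith)

lemma lq_le_grid (ν : Measure ℝ) [IsProbabilityMeasure ν] {R δ q : ℝ} (hδ : 0 < δ)
    (hR : ν (Icc (-R) R)ᶜ = 0) (hq : 0 < q) (hq1 : q ≤ 1) :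
    lqInt ν q δ ≤ ∑ n ∈ gridF R δ, cellMass ν δ n ^ q := by
  calc lqInt ν q δ ≤ ∫ x, cellMass ν δ ⌊x / δ⌋ ^ (q - 1) ∂ν := by
        apply integral_mono_ae (ball_integrable ν hδ hR)
          (grid_integrable ν hδ hR (fun n => cellMass ν δ n ^ (q - 1)))
        filter_upwards [ae_cell_pos ν δ] with x hx
        exact Real.rpow_le_rpow_of_nonpos hx (cell_le_ball ν hδ x) (by linarith)
    _ = _ := by
        rw [grid_integral ν hδ hR (fun n => cellMass ν δ n ^ (q - 1))]
        exact Finset.sum_congr rfl fun n _ => mul_rpow_sub_one (cm_nonneg _ _ _) hq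

lemma grid_le_lq (ν : Measure ℝ) [IsProbabilityMeasure ν] {R δ q : ℝ} (hδ : 0 < δ)
    (hR : ν (Icc (-R) R)ᶜ = 0) (hq1 : 1 ≤ q) :
    ∑ n ∈ gridF R δ, cellMass ν δ n ^ q ≤ lqInt ν q δ := by
  calc ∑ n ∈ gridF R δ, cellMass ν δ n ^ q = ∫ x, cellMass ν δ ⌊x / δ⌋ ^ (q - 1) ∂ν := by
        rw [grid_integral ν hδ hR (fun n => cellMass ν δ n ^ (q - 1))]
        exact Finset.sum_congr rfl fun n _ =>
          (mul_rpow_sub_one (cm_nonneg _ _ _) (by linarith)).symm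
    _ ≤ _ := by
        apply integral_mono (grid_integrable ν hδ hR (fun n => cellMass ν δ n ^ (q - 1)))
          (ball_integrable ν hδ hR)
        intro x
        exact Real.rpow_le_rpow (cm_nonneg _ _ _) (cell_le_ball ν hδ x) (by linarith)

/-- Lower bound for `q ≤ 1` through neighbouring cells. -/
lemma nbr_le_lq (ν : Measure ℝ) [IsProbabilityMeasure ν] {R δ q : ℝ} (hδ : 0 < δ)
    (hR : ν (Icc (-R) R)ᶜ = 0) (hq1 : q ≤ 1) :
    ∑ n ∈ gridF R δ, cellMass ν δ n *
      (cellMass ν δ (n - 1) + cellMass ν δ n + cellMass ν δ (n + 1)) ^ (q - 1) ≤ lqInt ν q δ := by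
  rw [← grid_integral ν hδ hR (fun n =>
    (cellMass ν δ (n - 1) + cellMass ν δ n + cellMass ν δ (n + 1)) ^ (q - 1))]
  apply integral_mono_ae (grid_integrable ν hδ hR (fun n =>
    (cellMass ν δ (n - 1) + cellMass ν δ n + cellMass ν δ (n + 1)) ^ (q - 1)))
    (ball_integrable ν hδ hR)
  filter_upwards [ae_cell_pos ν δ] with x hx
  exact Real.rpow_le_rpow_of_nonpos (hx.trans_le (cell_le_ball ν hδ x)) (ball_le_cells ν hδ x)
    (by linarith)

lemma shift_sum_le {G : Finset ℤ} {g : ℤ → ℝ} (hg : ∀ n, 0 ≤ g n) (h0 : ∀ n ∉ G, g n = 0) (m : ℤ) :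
    ∑ n ∈ G, g (n + m) ≤ ∑ n ∈ G, g n := by
  have hs : Summable g := summable_of_ne_finset_zero h0
  have hs2 : Summable (fun n => g (n + m)) := (Equiv.addRight m).summable_iff.2 hs
  calc ∑ n ∈ G, g (n + m) ≤ ∑' n, g (n + m) := hs2.sum_le_tsum _ (fun n _ => hg _)
    _ = ∑' n, g n := (Equiv.addRight m).tsum_eq g
    _ = _ := tsum_eq_sum h0

lemma nbr_bound {q : ℝ} (hq : 0 < q) (hq1 : q ≤ 1) {a b d K : ℝ} (ha : 0 ≤ a) (hb : 0 ≤ b)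
    (hd : 0 ≤ d) (hK : 1 ≤ K) :
    a ^ q ≤ K ^ (1 - q) * (a * (b + a + d) ^ (q - 1)) + K ^ (-q) * (b ^ q + a ^ q + d ^ q) := by
  have hK0 : 0 < K := by linarith
  have e2 : 0 ≤ K ^ (-q) * (b ^ q + a ^ q + d ^ q) := by positivity
  have e1 : 0 ≤ K ^ (1 - q) * (a * (b + a + d) ^ (q - 1)) := by positivity
  rcases ha.eq_or_lt with h0 | h0
  · have : a ^ q = 0 := by rw [← h0, Real.zero_rpow hq.ne']
    linarith
  by_cases h : b + a + d ≤ K * a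
  · have h1 : (K * a) ^ (q - 1) ≤ (b + a + d) ^ (q - 1) :=
      Real.rpow_le_rpow_of_nonpos (by linarith) h (by linarith)
    have h2 : K ^ (1 - q) * (a * (K * a) ^ (q - 1)) = a ^ q := by
      rw [Real.mul_rpow hK0.le h0.le, show 1 - q = -(q - 1) by ring, Real.rpow_neg hK0.le,
        ← mul_rpow_sub_one ha hq]
      have : K ^ (q - 1) ≠ 0 := (Real.rpow_pos_of_pos hK0 _).ne'
      field_simp
    have h3 : K ^ (1 - q) * (a * (K * a) ^ (q - 1)) ≤ K ^ (1 - q) * (a * (b + a + d) ^ (q - 1)) := by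
      gcongr
    linarith
  · push Not at h
    have h1 : (K * a) ^ q ≤ (b + a + d) ^ q := Real.rpow_le_rpow (by positivity) h.le hq.le
    have h2 : (b + a + d) ^ q ≤ b ^ q + a ^ q + d ^ q := by
      have := Real.rpow_add_le_add_rpow (add_nonneg hb ha) hd hq.le hq1
      have := Real.rpow_add_le_add_rpow hb ha hq.le hq1
      linarith
    have h3 : a ^ q = K ^ (-q) * (K * a) ^ q := by
      rw [Real.mul_rpow hK0.le h0.le, Real.rpow_neg hK0.le]
      have : K ^ q ≠ 0 := (Real.rpow_pos_of_pos hK0 _).ne'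
      field_simp
    have h4 : K ^ (-q) * (K * a) ^ q ≤ K ^ (-q) * (b ^ q + a ^ q + d ^ q) := by
      gcongr; linarith
    linarith

lemma grid_le_lq' {q : ℝ} (hq : 0 < q) (hq1 : q ≤ 1) : ∃ C : ℝ, 0 < C ∧
    ∀ (ν : Measure ℝ) [IsProbabilityMeasure ν] (R δ : ℝ), 0 < δ → ν (Icc (-R) R)ᶜ = 0 →
      ∑ n ∈ gridF R δ, cellMass ν δ n ^ q ≤ C * lqInt ν q δ := by
  set K : ℝ := 6 ^ (1 / q) with hKdef
  have hK : 1 ≤ K := Real.one_le_rpow (by norm_num) (by positivity)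
  have hKq : K ^ (-q) = 1 / 6 := by
    rw [hKdef, ← Real.rpow_mul (by norm_num), show 1 / q * -q = -1 by field_simp,
      Real.rpow_neg_one]; norm_num
  refine ⟨2 * K ^ (1 - q), by positivity, fun ν _ R δ hδ hR => ?_⟩
  set a := cellMass ν δ with ha
  have key := Finset.sum_le_sum (s := gridF R δ) fun n _ =>
    nbr_bound hq hq1 (cm_nonneg ν δ n) (cm_nonneg ν δ (n - 1)) (cm_nonneg ν δ (n + 1)) hK
  rw [Finset.sum_add_distrib, ← Finset.mul_sum, ← Finset.mul_sum, Finset.sum_add_distrib,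
    Finset.sum_add_distrib, hKq] at key
  have g0 : ∀ n ∉ gridF R δ, cellMass ν δ n ^ q = 0 := fun n hn => by
    rw [cell_zero ν hδ hR n hn, Real.zero_rpow hq.ne']
  have gn : ∀ n, 0 ≤ cellMass ν δ n ^ q := fun n => Real.rpow_nonneg (cm_nonneg _ _ _) _
  have s1 := shift_sum_le gn g0 (-1)
  have s2 := shift_sum_le gn g0 1
  simp only [← sub_eq_add_neg] at s1
  have l := mul_le_mul_of_nonneg_left (nbr_le_lq ν hδ hR hq1) (show 0 ≤ K ^ (1 - q) by positivity)
  linarith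

/-- Comparison of `L^q` integrals of comparable measures. -/
lemma lq_compare {q e : ℝ} (hq : 0 < q) (he : 0 < e) : ∃ C : ℝ, 0 < C ∧
    ∀ (ν ρ : Measure ℝ) [IsProbabilityMeasure ν] [IsProbabilityMeasure ρ] (R δ : ℝ), 0 < δ →
      ν (Icc (-R) R)ᶜ = 0 → ρ (Icc (-R) R)ᶜ = 0 → ENNReal.ofReal e • ρ ≤ ν →
      C * lqInt ρ q δ ≤ lqInt ν q δ := by
  have hset : ∀ (ν ρ : Measure ℝ) [IsProbabilityMeasure ν], ENNReal.ofReal e • ρ ≤ ν → ∀ A,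
      e * (ρ A).toReal ≤ (ν A).toReal := by
    intro ν ρ _ h A
    have := ENNReal.toReal_mono (measure_ne_top ν A) (h A)
    simpa [ENNReal.toReal_mul, ENNReal.toReal_ofReal he.le] using this
  rcases le_total 1 q with h1 | h1
  · refine ⟨e ^ q, by positivity, fun ν ρ _ _ R δ hδ hν hρ hle => ?_⟩
    have i1 := integral_mono_measure (f := fun x : ℝ => (ν (Metric.ball x δ)).toReal ^ (q - 1)) hle
      (Eventually.of_forall fun x => by positivity) (ball_integrable ν hδ hν)
    rw [integral_smul_measure, ENNReal.toReal_ofReal he.le, smul_eq_mul] at i1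
    have i2 : e ^ (q - 1) * lqInt ρ q δ ≤ ∫ x, (ν (Metric.ball x δ)).toReal ^ (q - 1) ∂ρ := by
      rw [lqInt, ← integral_const_mul]
      apply integral_mono ((ball_integrable ρ hδ hρ).const_mul _)
      · apply Integrable.of_bound (C := 1) (meas_ball ν q δ).aestronglyMeasurable
        refine Eventually.of_forall fun x => ?_
        rw [Real.norm_eq_abs, abs_of_nonneg (by positivity)]
        exact Real.rpow_le_one ENNReal.toReal_nonneg measureReal_le_one (by linarith)
      · intro x
        simp only
        rw [← Real.mul_rpow he.le ENNReal.toReal_nonneg]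
        exact Real.rpow_le_rpow (by positivity) (hset ν ρ hle _) (by linarith)
    calc e ^ q * lqInt ρ q δ = e * (e ^ (q - 1) * lqInt ρ q δ) := by
          rw [← mul_rpow_sub_one he.le hq]; ring
      _ ≤ _ := (mul_le_mul_of_nonneg_left i2 he.le).trans i1
  · obtain ⟨C, hC, h⟩ := grid_le_lq' hq h1
    refine ⟨e ^ q / C, by positivity, fun ν ρ _ _ R δ hδ hν hρ hle => ?_⟩
    have j1 := lq_le_grid ρ hδ hρ hq h1
    have j2 := h ν R δ hδ hν
    have j3 : e ^ q * ∑ n ∈ gridF R δ, cellMass ρ δ n ^ q ≤ ∑ n ∈ gridF R δ, cellMass ν δ n ^ q := by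
      rw [Finset.mul_sum]
      apply Finset.sum_le_sum
      intro n _
      rw [← Real.mul_rpow he.le (cm_nonneg _ _ _)]
      exact Real.rpow_le_rpow (mul_nonneg he.le (cm_nonneg _ _ _)) (hset ν ρ hle _) hq.le
    have j4 : e ^ q * lqInt ρ q δ ≤ C * lqInt ν q δ :=
      (mul_le_mul_of_nonneg_left j1 (by positivity)).trans (j3.trans j2)
    rw [div_mul_eq_mul_div, div_le_iff₀ hC]
    linarith

lemma card_grid {R δ : ℝ} (hR : 0 ≤ R) (hδ : 0 < δ) (hδ1 : δ < 1) :
    ((gridF R δ).card : ℝ) ≤ (2 * R + 2) / δ := by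
  have h0 : ⌊-R / δ⌋ ≤ ⌊R / δ⌋ := Int.floor_mono (by gcongr; linarith)
  have : ((gridF R δ).card : ℝ) = (⌊R / δ⌋ : ℝ) + 1 - ⌊-R / δ⌋ := by
    rw [gridF, Int.card_Icc]
    have : (((⌊R / δ⌋ + 1 - ⌊-R / δ⌋).toNat : ℤ) : ℝ) = ((⌊R / δ⌋ + 1 - ⌊-R / δ⌋ : ℤ) : ℝ) := by
      rw [Int.toNat_of_nonneg (by omega)]
    push_cast at this
    exact_mod_cast this
  rw [this]
  have a1 := Int.floor_le (R / δ)
  have a2 := Int.lt_floor_add_one (-R / δ)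
  have a3 : 1 ≤ 1 / δ := by rw [le_div_iff₀ hδ]; linarith
  have : (2 * R + 2) / δ = 2 * (R / δ) + 2 * (1 / δ) := by ring
  have : -R / δ = -(R / δ) := by ring
  linarith

lemma lq_bounds (ν : Measure ℝ) [IsProbabilityMeasure ν] {R δ q : ℝ} (hδ : 0 < δ) (hδ1 : δ < 1)
    (hR0 : 0 ≤ R) (hR : ν (Icc (-R) R)ᶜ = 0) (hq : 0 < q) :
    0 < lqInt ν q δ ∧
      |Real.log (lqInt ν q δ)| ≤ (q + 1) * (Real.log (2 * R + 2) - Real.log δ) := by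
  set N : ℝ := ((gridF R δ).card : ℝ) with hN
  have hne : (gridF R δ).Nonempty := by
    by_contra h
    rw [Finset.not_nonempty_iff_eq_empty] at h
    have := cells_sum ν hδ hR
    rw [h] at this; simp at this
  have hN1 : 1 ≤ N := by
    rw [hN]; exact_mod_cast hne.card_pos
  have hlogN : Real.log N ≤ Real.log (2 * R + 2) - Real.log δ := by
    rw [← Real.log_div (by positivity) hδ.ne']
    exact Real.log_le_log (by linarith) (card_grid hR0 hδ hδ1)
  have hlogN0 : 0 ≤ Real.log N := Real.log_nonneg hN1
  rcases le_total 1 q with h1 | h1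
  · obtain ⟨n, hn, hle⟩ := Finset.exists_le_of_sum_le (f := fun _ => 1 / N)
      (g := cellMass ν δ) hne (by
        rw [cells_sum ν hδ hR, Finset.sum_const, nsmul_eq_mul, ← hN, mul_one_div_cancel]
        linarith)
    have l1 : (1 / N) ^ q ≤ lqInt ν q δ :=
      calc (1 / N) ^ q ≤ cellMass ν δ n ^ q := Real.rpow_le_rpow (by positivity) hle hq.le
        _ ≤ ∑ n ∈ gridF R δ, cellMass ν δ n ^ q :=
          Finset.single_le_sum (f := fun n => cellMass ν δ n ^ q)
            (fun n _ => Real.rpow_nonneg (cm_nonneg _ _ _) _) hn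
        _ ≤ _ := grid_le_lq ν hδ hR h1
    have l0 : 0 < (1 / N) ^ q := by positivity
    have l2 : lqInt ν q δ ≤ 1 := by
      have := integral_mono (ball_integrable (q := q) ν hδ hR) (integrable_const (1 : ℝ)) (fun x =>
        Real.rpow_le_one ENNReal.toReal_nonneg measureReal_le_one (by linarith))
      simpa [lqInt] using this
    refine ⟨l0.trans_le l1, ?_⟩
    have l3 := Real.log_le_log l0 l1
    rw [Real.log_rpow (by positivity), one_div, Real.log_inv] at l3
    rw [abs_of_nonpos (Real.log_nonpos (l0.trans_le l1).le l2)]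
    nlinarith
  · have l1 : 1 ≤ lqInt ν q δ := by
      have := integral_mono_ae (integrable_const (1 : ℝ)) (ball_integrable (q := q) ν hδ hR) (by
        filter_upwards [ae_cell_pos ν δ] with x hx
        exact Real.one_le_rpow_of_pos_of_le_one_of_nonpos (hx.trans_le (cell_le_ball ν hδ x))
          measureReal_le_one (by linarith))
      simpa [lqInt] using this
    have l2 : lqInt ν q δ ≤ N := by
      refine (lq_le_grid ν hδ hR hq h1).trans ?_
      calc ∑ n ∈ gridF R δ, cellMass ν δ n ^ q ≤ ∑ n ∈ gridF R δ, (1 : ℝ) :=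
            Finset.sum_le_sum fun n _ =>
              Real.rpow_le_one (cm_nonneg _ _ _) (cm_le_one _ _ _) hq.le
        _ = N := by simp [hN]
    refine ⟨by linarith, ?_⟩
    rw [abs_of_nonneg (Real.log_nonneg l1)]
    have := Real.log_le_log (by linarith) l2
    nlinarith

lemma lq_tendsto (ν : Measure ℝ) [IsProbabilityMeasure ν] {R q t : ℝ}
    (hR0 : 0 ≤ R) (hR : ν (Icc (-R) R)ᶜ = 0) (hq : 0 < q) (h : IsLqSpec ν q t) :
    Tendsto (fun δ : ℝ => Real.log (lqInt ν q δ) / (-Real.log δ)) (nhdsWithin 0 (Set.Ioi 0))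
      (nhds t) := by
  have hb : IsBoundedUnder (· ≤ ·) (nhdsWithin (0 : ℝ) (Set.Ioi 0))
      (fun δ : ℝ => |Real.log (lqInt ν q δ) / (-Real.log δ)|) := by
    refine ⟨(q + 1) * (Real.log (2 * R + 2) + 1), ?_⟩
    rw [eventually_map]
    filter_upwards [Ioo_mem_nhdsGT (Real.exp_pos (-1))] with δ hδ
    have hδ1 : Real.log δ < -1 := by rw [Real.log_lt_iff_lt_exp hδ.1]; exact hδ.2
    have hδ2 : δ < 1 := hδ.2.trans (by rw [Real.exp_lt_one_iff]; norm_num)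
    have hB := (lq_bounds ν hδ.1 hδ2 hR0 hR hq).2
    have hl : 0 ≤ Real.log (2 * R + 2) := Real.log_nonneg (by linarith)
    rw [abs_div, abs_of_pos (show 0 < -Real.log δ by linarith), div_le_iff₀ (by linarith)]
    refine hB.trans ?_
    rw [mul_assoc]
    apply mul_le_mul_of_nonneg_left _ (by linarith)
    nlinarith
  rw [isBoundedUnder_le_abs] at hb
  exact tendsto_of_liminf_eq_limsup h.1 h.2 hb.1 hb.2

lemma lq_scale (ν : Measure ℝ) [IsProbabilityMeasure ν] {σ t q δ : ℝ} (hσ : σ ≠ 0) :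
    lqInt (Measure.map (fun y => σ * y + t) ν) q δ = lqInt ν q (δ / |σ|) := by
  have hm : Measurable (fun y : ℝ => σ * y + t) := by fun_prop
  have : IsProbabilityMeasure (Measure.map (fun y => σ * y + t) ν) :=
    Measure.isProbabilityMeasure_map hm.aemeasurable
  rw [lqInt, integral_map hm.aemeasurable (meas_ball _ q δ).aestronglyMeasurable, lqInt]
  congr 1
  ext y
  rw [Measure.map_apply hm Metric.isOpen_ball.measurableSet]
  congr 3
  ext z
  simp only [mem_preimage, Metric.mem_ball, Real.dist_eq]
  rw [lt_div_iff₀ (abs_pos.2 hσ), ← abs_mul]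
  ring_nf

lemma tau_le (ν ν' : Measure ℝ) [IsProbabilityMeasure ν] [IsProbabilityMeasure ν']
    {R q t t' σ b e : ℝ} (hR0 : 0 ≤ R) (hR : ν (Icc (-R) R)ᶜ = 0) (hR' : ν' (Icc (-R) R)ᶜ = 0)
    (hq : 0 < q) (h : IsLqSpec ν q t) (h' : IsLqSpec ν' q t') (hσ : σ ≠ 0) (he : 0 < e)
    (hle : ENNReal.ofReal e • Measure.map (fun y => σ * y + b) ν' ≤ ν) : t' ≤ t := by
  have hm : Measurable (fun y : ℝ => σ * y + b) := by fun_prop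
  have : IsProbabilityMeasure (Measure.map (fun y => σ * y + b) ν') :=
    Measure.isProbabilityMeasure_map hm.aemeasurable
  have hρR : (Measure.map (fun y => σ * y + b) ν') (Icc (-R) R)ᶜ = 0 := by
    have := hle (Icc (-R) R)ᶜ
    rw [hR, Measure.smul_apply, smul_eq_mul] at this
    have := (mul_eq_zero.1 (le_antisymm this zero_le)).resolve_left
      (by simpa using he)
    exact this
  obtain ⟨C, hC, hcomp⟩ := lq_compare hq he
  have T1 := lq_tendsto ν hR0 hR hq h
  have T2 := lq_tendsto ν' hR0 hR' hq h'
  have hs0 : 0 < |σ| := abs_pos.2 hσ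
  have hsc : Tendsto (fun δ : ℝ => δ / |σ|) (nhdsWithin 0 (Set.Ioi 0))
      (nhdsWithin 0 (Set.Ioi 0)) := by
    apply tendsto_nhdsWithin_iff.2
    constructor
    · have : Tendsto (fun δ : ℝ => δ / |σ|) (nhds 0) (nhds (0 / |σ|)) :=
        (continuous_id.div_const _).tendsto 0
      rw [zero_div] at this
      exact this.mono_left nhdsWithin_le_nhds
    · filter_upwards [self_mem_nhdsWithin] with δ hδ
      exact div_pos hδ hs0
  have T3 := T2.comp hsc
  have hlog : Tendsto (fun δ : ℝ => (Real.log δ)⁻¹) (nhdsWithin 0 (Set.Ioi 0)) (nhds 0) :=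
    tendsto_inv_atBot_zero.comp Real.tendsto_log_nhdsGT_zero
  have T4 := (T3.mul ((hlog.const_mul (Real.log |σ|)).const_sub 1)).sub (hlog.const_mul (Real.log C))
  simp only [mul_zero, sub_zero, mul_one] at T4
  apply le_of_tendsto_of_tendsto T4 T1
  filter_upwards [Ioo_mem_nhdsGT (show (0 : ℝ) < min 1 |σ| by positivity)] with δ hδ
  have hδ0 := hδ.1
  have hδ1 : δ < 1 := hδ.2.trans_le (min_le_left _ _)
  have hδ2 : δ / |σ| < 1 := by rw [div_lt_one hs0]; exact hδ.2.trans_le (min_le_right _ _)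
  have hl : Real.log δ < 0 := Real.log_neg hδ0 hδ1
  have hl2 : Real.log (δ / |σ|) < 0 := Real.log_neg (by positivity) hδ2
  have key := hcomp ν _ R δ hδ0 hR hρR hle
  rw [lq_scale ν' hσ] at key
  have p1 := (lq_bounds ν' (show 0 < δ / |σ| by positivity) hδ2 hR0 hR' hq).1
  have key2 := Real.log_le_log (by positivity) key
  rw [Real.log_mul hC.ne' p1.ne'] at key2
  simp only [Function.comp]
  rw [Real.log_div hδ0.ne' hs0.ne'] at hl2 ⊢
  rw [le_div_iff₀ (by linarith)]
  refine le_trans (le_of_eq ?_) key2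
  have hl' := hl.ne
  have : Real.log δ - Real.log |σ| ≠ 0 := hl2.ne
  field_simp
  ring

/-! ### Part B: the algebra of words -/

lemma dims_append {ι : Type} (B : IFSData ι) (i j : List ι) :
    B.dims (i ++ j) = ((B.dims i).1 * (if B.swapW i then (B.dims j).2 else (B.dims j).1),
      (B.dims i).2 * (if B.swapW i then (B.dims j).1 else (B.dims j).2)) := by
  induction i with
  | nil => simp [IFSData.dims, IFSData.swapW]
  | cons a l ih =>
    have h1 : ∀ m, B.dims (a :: m) = (B.c a * (if B.swap a then (B.dims m).2 else (B.dims m).1),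
      B.d a * (if B.swap a then (B.dims m).1 else (B.dims m).2)) := fun m => rfl
    have h2 : B.swapW (a :: l) = xor (B.swap a) (B.swapW l) := rfl
    rw [List.cons_append, h1, ih, h1, h2]
    cases B.swap a <;> cases B.swapW l <;> simp [mul_assoc]

lemma dims_pos {ι : Type} (B : IFSData ι)
    (hc : ∀ i, B.c i ∈ Set.Ioo (0 : ℝ) 1) (hd : ∀ i, B.d i ∈ Set.Ioo (0 : ℝ) 1) (l : List ι) :
    (0 < (B.dims l).1 ∧ 0 < (B.dims l).2) ∧ ((B.dims l).1 ≤ 1 ∧ (B.dims l).2 ≤ 1) := by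
  induction l with
  | nil => simp [IFSData.dims]
  | cons a l ih =>
    have h1 : B.dims (a :: l) = (B.c a * (if B.swap a then (B.dims l).2 else (B.dims l).1),
      B.d a * (if B.swap a then (B.dims l).1 else (B.dims l).2)) := rfl
    obtain ⟨⟨p1, p2⟩, q1, q2⟩ := ih
    obtain ⟨c1, c2⟩ := hc a
    obtain ⟨d1, d2⟩ := hd a
    rw [h1]
    cases B.swap a
    · simp only [Bool.false_eq_true, if_false]
      exact ⟨⟨by positivity, by positivity⟩, mul_le_one₀ c2.le p1.le q1, mul_le_one₀ d2.le p2.le q2⟩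
    · simp only [if_true]
      exact ⟨⟨by positivity, by positivity⟩, mul_le_one₀ c2.le p2.le q2, mul_le_one₀ d2.le p1.le q1⟩

lemma alpha2_lt_one {ι : Type} (B : IFSData ι)
    (hc : ∀ i, B.c i ∈ Set.Ioo (0 : ℝ) 1) (hd : ∀ i, B.d i ∈ Set.Ioo (0 : ℝ) 1) (l : List ι)
    (hl : l ≠ []) : B.alpha2 l < 1 := by
  cases l with
  | nil => exact absurd rfl hl
  | cons a l =>
    have h1 : B.dims (a :: l) = (B.c a * (if B.swap a then (B.dims l).2 else (B.dims l).1),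
      B.d a * (if B.swap a then (B.dims l).1 else (B.dims l).2)) := rfl
    obtain ⟨⟨p1, p2⟩, q1, q2⟩ := dims_pos B hc hd l
    obtain ⟨c1, c2⟩ := hc a
    refine (min_le_left _ _).trans_lt ?_
    rw [h1]
    cases B.swap a
    · simp only [Bool.false_eq_true, if_false]; nlinarith
    · simp only [if_true]; nlinarith

lemma alpha_pos {ι : Type} (B : IFSData ι)
    (hc : ∀ i, B.c i ∈ Set.Ioo (0 : ℝ) 1) (hd : ∀ i, B.d i ∈ Set.Ioo (0 : ℝ) 1) (l : List ι) :
    0 < B.alpha1 l ∧ 0 < B.alpha2 l := by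
  obtain ⟨⟨p1, p2⟩, _⟩ := dims_pos B hc hd l
  exact ⟨lt_max_of_lt_left p1, lt_min p1 p2⟩

lemma swapW_false {ι : Type} (B : IFSData ι) (h : ∀ i, B.swap i = false) (l : List ι) :
    B.swapW l = false := by
  induction l with
  | nil => rfl
  | cons a l ih =>
    have h2 : B.swapW (a :: l) = xor (B.swap a) (B.swapW l) := rfl
    rw [h2, ih, h]; rfl

lemma wordProb_append {ι : Type} (p : ι → ℝ) (i j : List ι) :
    wordProb p (i ++ j) = wordProb p i * wordProb p j := by simp [wordProb]

lemma wordProb_pos {ι : Type} (p : ι → ℝ) (hp : ∀ i, p i ∈ Set.Ioo (0 : ℝ) 1) (l : List ι) :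
    0 < wordProb p l := by
  apply List.prod_pos
  intro x hx
  obtain ⟨i, _, rfl⟩ := List.mem_map.1 hx
  exact (hp i).1

/-- The logarithm of the singular value part. -/
def gM (E1 E2 s u v : ℝ) : ℝ := E1 * u + (s - E1) * v + (E1 + E2 - s) * max (v - u) 0

lemma gM_sub {E1 E2 s : ℝ} (h : s ≤ E1 + E2) (u v u' v' : ℝ) :
    gM E1 E2 s (u + u') (v + v') ≤ gM E1 E2 s u v + gM E1 E2 s u' v' := by
  have : max (v + v' - (u + u')) 0 ≤ max (v - u) 0 + max (v' - u') 0 := by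
    apply max_le
    · linarith [le_max_left (v - u) 0, le_max_left (v' - u') 0]
    · positivity
  unfold gM
  nlinarith [mul_le_mul_of_nonneg_left this (sub_nonneg.2 h)]

lemma gM_super {E1 E2 s : ℝ} (h : E1 + E2 ≤ s) (u v u' v' : ℝ) :
    gM E1 E2 s u v + gM E1 E2 s u' v' ≤ gM E1 E2 s (u + u') (v + v') := by
  have : max (v + v' - (u + u')) 0 ≤ max (v - u) 0 + max (v' - u') 0 := by
    apply max_le
    · linarith [le_max_left (v - u) 0, le_max_left (v' - u') 0]
    · positivity
  unfold gM
  nlinarith [mul_le_mul_of_nonneg_left this (sub_nonneg.2 h)]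

lemma gM_symm (E s u v : ℝ) : gM E E s u v = gM E E s v u := by
  unfold gM
  rcases le_total u v with h | h
  · rw [max_eq_left (by linarith), max_eq_right (by linarith)]; ring
  · rw [max_eq_right (by linarith), max_eq_left (by linarith)]; ring

lemma log_sv {ι : Type} (B : IFSData ι)
    (hc : ∀ i, B.c i ∈ Set.Ioo (0 : ℝ) 1) (hd : ∀ i, B.d i ∈ Set.Ioo (0 : ℝ) 1)
    {E1 E2 : ℝ} (H : (∀ i, B.swap i = false) ∨ E1 = E2) (s : ℝ) (l : List ι) :
    tauWD B E1 E2 l * Real.log (B.alpha1 l) + (s - tauWD B E1 E2 l) * Real.log (B.alpha2 l)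
      = gM E1 E2 s (Real.log (B.dims l).1) (Real.log (B.dims l).2) := by
  obtain ⟨⟨p1, p2⟩, _⟩ := dims_pos B hc hd l
  unfold IFSData.alpha1 IFSData.alpha2 tauWD IFSData.usesPi1 gM
  rcases le_or_gt (B.dims l).2 (B.dims l).1 with h | h
  · have hl := Real.log_le_log p2 h
    rw [max_eq_left h, min_eq_right h, max_eq_right (by linarith)]
    rcases H with H | H
    · rw [if_pos (Or.inl ⟨swapW_false B H l, h⟩)]; ring
    · subst H; simp only [ite_self]; ring
  · have hl := Real.log_lt_log p1 h
    rw [max_eq_right h.le, min_eq_left h.le, max_eq_left (by linarith)]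
    rcases H with H | H
    · rw [if_neg]
      · ring
      · rw [swapW_false B H l]
        simp [h]
    · subst H; simp only [ite_self]; ring

/-- logarithm of the singular value part of a word. -/
def lsv {ι : Type} (B : IFSData ι) (E1 E2 s : ℝ) (l : List ι) : ℝ :=
  gM E1 E2 s (Real.log (B.dims l).1) (Real.log (B.dims l).2)

lemma lsv_append {ι : Type} (B : IFSData ι)
    (hc : ∀ i, B.c i ∈ Set.Ioo (0 : ℝ) 1) (hd : ∀ i, B.d i ∈ Set.Ioo (0 : ℝ) 1)
    {E1 E2 : ℝ} (H : (∀ i, B.swap i = false) ∨ E1 = E2) (s : ℝ) (i j : List ι) :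
    (s ≤ E1 + E2 → lsv B E1 E2 s (i ++ j) ≤ lsv B E1 E2 s i + lsv B E1 E2 s j) ∧
    (E1 + E2 ≤ s → lsv B E1 E2 s i + lsv B E1 E2 s j ≤ lsv B E1 E2 s (i ++ j)) := by
  obtain ⟨⟨p1, p2⟩, _⟩ := dims_pos B hc hd i
  obtain ⟨⟨p3, p4⟩, _⟩ := dims_pos B hc hd j
  unfold lsv
  rw [dims_append]
  cases hsw : B.swapW i
  · simp only [Bool.false_eq_true, if_false]
    rw [Real.log_mul p1.ne' p3.ne', Real.log_mul p2.ne' p4.ne']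
    exact ⟨fun h => gM_sub h _ _ _ _, fun h => gM_super h _ _ _ _⟩
  · rcases H with H | H
    · rw [swapW_false B H i] at hsw; cases hsw
    · subst H
      simp only [if_true]
      rw [Real.log_mul p1.ne' p4.ne', Real.log_mul p2.ne' p3.ne',
        gM_symm E1 s (Real.log (B.dims j).1)]
      exact ⟨fun h => gM_sub h _ _ _ _, fun h => gM_super h _ _ _ _⟩

lemma psiHat_pos {ι : Type} (B : IFSData ι)
    (hc : ∀ i, B.c i ∈ Set.Ioo (0 : ℝ) 1) (hd : ∀ i, B.d i ∈ Set.Ioo (0 : ℝ) 1)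
    (p : ι → ℝ) (hp : ∀ i, p i ∈ Set.Ioo (0 : ℝ) 1) (D1 D2 s : ℝ) (l : List ι) :
    0 < psiHat B p D1 D2 s l := by
  obtain ⟨h1, h2⟩ := alpha_pos B hc hd l
  have := wordProb_pos p hp l
  unfold psiHat
  positivity

lemma psiSV_pos {ι : Type} (B : IFSData ι)
    (hc : ∀ i, B.c i ∈ Set.Ioo (0 : ℝ) 1) (hd : ∀ i, B.d i ∈ Set.Ioo (0 : ℝ) 1)
    (p : ι → ℝ) (hp : ∀ i, p i ∈ Set.Ioo (0 : ℝ) 1) (τ1 τ2 : ℝ → ℝ) (s q : ℝ) (l : List ι) :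
    0 < psiSV B p τ1 τ2 s q l := by
  obtain ⟨h1, h2⟩ := alpha_pos B hc hd l
  have := wordProb_pos p hp l
  unfold psiSV
  positivity

lemma log_psiHat {ι : Type} (B : IFSData ι)
    (hc : ∀ i, B.c i ∈ Set.Ioo (0 : ℝ) 1) (hd : ∀ i, B.d i ∈ Set.Ioo (0 : ℝ) 1)
    (p : ι → ℝ) (hp : ∀ i, p i ∈ Set.Ioo (0 : ℝ) 1)
    {D1 D2 : ℝ} (H : (∀ i, B.swap i = false) ∨ D1 = D2) (s : ℝ) (l : List ι) :
    Real.log (psiHat B p D1 D2 s l) = Real.log (wordProb p l) + lsv B D1 D2 s l := by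
  obtain ⟨h1, h2⟩ := alpha_pos B hc hd l
  have := wordProb_pos p hp l
  rw [lsv, ← log_sv B hc hd H, psiHat, Real.log_mul (by positivity) (by positivity),
    Real.log_mul (by positivity) (by positivity), Real.log_rpow h1, Real.log_rpow h2, add_assoc]

lemma log_psiSV {ι : Type} (B : IFSData ι)
    (hc : ∀ i, B.c i ∈ Set.Ioo (0 : ℝ) 1) (hd : ∀ i, B.d i ∈ Set.Ioo (0 : ℝ) 1)
    (p : ι → ℝ) (hp : ∀ i, p i ∈ Set.Ioo (0 : ℝ) 1) (τ1 τ2 : ℝ → ℝ) (q : ℝ)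
    (H : (∀ i, B.swap i = false) ∨ τ1 q = τ2 q) (s : ℝ) (l : List ι) :
    Real.log (psiSV B p τ1 τ2 s q l) =
      q * Real.log (wordProb p l) + lsv B (τ1 q) (τ2 q) s l := by
  obtain ⟨h1, h2⟩ := alpha_pos B hc hd l
  have := wordProb_pos p hp l
  have e : tauW B τ1 τ2 l q = tauWD B (τ1 q) (τ2 q) l := rfl
  rw [lsv, ← log_sv B hc hd H, psiSV, Real.log_mul (by positivity) (by positivity),
    Real.log_mul (by positivity) (by positivity), Real.log_rpow h1, Real.log_rpow h2,
    Real.log_rpow this, add_assoc, e]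

lemma log_psiHat_append {ι : Type} (B : IFSData ι)
    (hc : ∀ i, B.c i ∈ Set.Ioo (0 : ℝ) 1) (hd : ∀ i, B.d i ∈ Set.Ioo (0 : ℝ) 1)
    (p : ι → ℝ) (hp : ∀ i, p i ∈ Set.Ioo (0 : ℝ) 1)
    {D1 D2 : ℝ} (H : (∀ i, B.swap i = false) ∨ D1 = D2) (s : ℝ) (i j : List ι) :
    (s ≤ D1 + D2 → Real.log (psiHat B p D1 D2 s (i ++ j)) ≤
      Real.log (psiHat B p D1 D2 s i) + Real.log (psiHat B p D1 D2 s j)) ∧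
    (D1 + D2 ≤ s → Real.log (psiHat B p D1 D2 s i) + Real.log (psiHat B p D1 D2 s j) ≤
      Real.log (psiHat B p D1 D2 s (i ++ j))) := by
  simp only [log_psiHat B hc hd p hp H, wordProb_append]
  rw [Real.log_mul (wordProb_pos p hp i).ne' (wordProb_pos p hp j).ne']
  have := lsv_append B hc hd H s i j
  exact ⟨fun h => by linarith [this.1 h], fun h => by linarith [this.2 h]⟩

lemma psiSV_append {ι : Type} (B : IFSData ι)
    (hc : ∀ i, B.c i ∈ Set.Ioo (0 : ℝ) 1) (hd : ∀ i, B.d i ∈ Set.Ioo (0 : ℝ) 1)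
    (p : ι → ℝ) (hp : ∀ i, p i ∈ Set.Ioo (0 : ℝ) 1) (τ1 τ2 : ℝ → ℝ) (q : ℝ)
    (H : (∀ i, B.swap i = false) ∨ τ1 q = τ2 q) (i j : List ι) :
    psiSV B p τ1 τ2 (τ1 q + τ2 q) q (i ++ j) =
      psiSV B p τ1 τ2 (τ1 q + τ2 q) q i * psiSV B p τ1 τ2 (τ1 q + τ2 q) q j := by
  have P := psiSV_pos B hc hd p hp τ1 τ2 (τ1 q + τ2 q) q
  apply Real.log_injOn_pos (P _) (mul_pos (P _) (P _))
  rw [Real.log_mul (P _).ne' (P _).ne']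
  simp only [log_psiSV B hc hd p hp τ1 τ2 q H, wordProb_append]
  rw [Real.log_mul (wordProb_pos p hp i).ne' (wordProb_pos p hp j).ne']
  have := lsv_append B hc hd H (τ1 q + τ2 q) i j
  linarith [this.1 le_rfl, this.2 le_rfl]

lemma sum_append {ι : Type} [Fintype ι] (k l : ℕ) (F : List ι → ℝ) :
    ∑ f : Fin (k + l) → ι, F (List.ofFn f) =
      ∑ f : Fin k → ι, ∑ g : Fin l → ι, F (List.ofFn f ++ List.ofFn g) := by
  rw [← Fintype.sum_prod_type', ← (Fin.appendEquiv k l).sum_comp]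
  apply Finset.sum_congr rfl
  intro x _
  rw [← List.ofFn_fin_append]
  rfl

lemma PsiSV_add {ι : Type} [Fintype ι] (B : IFSData ι)
    (hc : ∀ i, B.c i ∈ Set.Ioo (0 : ℝ) 1) (hd : ∀ i, B.d i ∈ Set.Ioo (0 : ℝ) 1)
    (p : ι → ℝ) (hp : ∀ i, p i ∈ Set.Ioo (0 : ℝ) 1) (τ1 τ2 : ℝ → ℝ) (q : ℝ)
    (H : (∀ i, B.swap i = false) ∨ τ1 q = τ2 q) (k l : ℕ) :
    PsiSV B p τ1 τ2 (k + l) (τ1 q + τ2 q) q =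
      PsiSV B p τ1 τ2 k (τ1 q + τ2 q) q * PsiSV B p τ1 τ2 l (τ1 q + τ2 q) q := by
  unfold PsiSV
  rw [sum_append k l (psiSV B p τ1 τ2 (τ1 q + τ2 q) q), Finset.sum_mul_sum]
  simp only [psiSV_append B hc hd p hp τ1 τ2 q H]

lemma PsiSV_pos {ι : Type} [Fintype ι] [Nonempty ι] (B : IFSData ι)
    (hc : ∀ i, B.c i ∈ Set.Ioo (0 : ℝ) 1) (hd : ∀ i, B.d i ∈ Set.Ioo (0 : ℝ) 1)
    (p : ι → ℝ) (hp : ∀ i, p i ∈ Set.Ioo (0 : ℝ) 1) (τ1 τ2 : ℝ → ℝ) (s q : ℝ) (k : ℕ) :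
    0 < PsiSV B p τ1 τ2 k s q :=
  Finset.sum_pos (fun _ _ => psiSV_pos B hc hd p hp τ1 τ2 s q _) Finset.univ_nonempty

lemma PsiSV_pow {ι : Type} [Fintype ι] [Nonempty ι] (B : IFSData ι)
    (hc : ∀ i, B.c i ∈ Set.Ioo (0 : ℝ) 1) (hd : ∀ i, B.d i ∈ Set.Ioo (0 : ℝ) 1)
    (p : ι → ℝ) (hp : ∀ i, p i ∈ Set.Ioo (0 : ℝ) 1) (τ1 τ2 : ℝ → ℝ) (q : ℝ)
    (H : (∀ i, B.swap i = false) ∨ τ1 q = τ2 q) (k : ℕ) :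
    PsiSV B p τ1 τ2 (k + 1) (τ1 q + τ2 q) q = PsiSV B p τ1 τ2 1 (τ1 q + τ2 q) q ^ (k + 1) := by
  induction k with
  | zero => simp
  | succ k ih => rw [PsiSV_add B hc hd p hp τ1 τ2 q H, ih, pow_succ _ (k + 1)]

lemma PsiSV_anti {ι : Type} [Fintype ι] [Nonempty ι] (B : IFSData ι)
    (hc : ∀ i, B.c i ∈ Set.Ioo (0 : ℝ) 1) (hd : ∀ i, B.d i ∈ Set.Ioo (0 : ℝ) 1)
    (p : ι → ℝ) (hp : ∀ i, p i ∈ Set.Ioo (0 : ℝ) 1) (τ1 τ2 : ℝ → ℝ) (q : ℝ)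
    {k : ℕ} (hk : 1 ≤ k) : StrictAnti (fun s => PsiSV B p τ1 τ2 k s q) := by
  intro s t hst
  apply Finset.sum_lt_sum_of_nonempty Finset.univ_nonempty
  intro f _
  have hne : List.ofFn f ≠ [] := by
    intro h
    have := congrArg List.length h
    simp at this; omega
  obtain ⟨h1, h2⟩ := alpha_pos B hc hd (List.ofFn f)
  have h3 := wordProb_pos p hp (List.ofFn f)
  unfold psiSV
  apply mul_lt_mul_of_pos_left _ (by positivity)
  exact Real.rpow_lt_rpow_of_exponent_gt h2 (alpha2_lt_one B hc hd _ hne) (by linarith)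

lemma PsiHat_expand {ι : Type} [Fintype ι] (B : IFSData ι)
    (hc : ∀ i, B.c i ∈ Set.Ioo (0 : ℝ) 1) (hd : ∀ i, B.d i ∈ Set.Ioo (0 : ℝ) 1)
    (p : ι → ℝ) (hp : ∀ i, p i ∈ Set.Ioo (0 : ℝ) 1) (τ1 τ2 : ℝ → ℝ) (q : ℝ)
    (γks : ℕ → ℝ → ℝ) (hγ : ∀ k, 1 ≤ k → γks k q = τ1 q + τ2 q)
    (h1 : ∀ k, 1 ≤ k → PsiSV B p τ1 τ2 k (τ1 q + τ2 q) q = 1)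
    (H : (∀ i, B.swap i = false) ∨ τ1 q = τ2 q) (D1 D2 s : ℝ) (k l : ℕ) (hk : 1 ≤ k)
    (hl : 1 ≤ l) :
    PsiHat B p τ1 τ2 γks D1 D2 (k + l) s q =
      (∑ f : Fin k → ι, ∑ g : Fin l → ι,
        (psiSV B p τ1 τ2 (τ1 q + τ2 q) q (List.ofFn f) *
          psiSV B p τ1 τ2 (τ1 q + τ2 q) q (List.ofFn g)) *
          Real.log (psiHat B p D1 D2 s (List.ofFn f ++ List.ofFn g))) ∧
    PsiHat B p τ1 τ2 γks D1 D2 k s q + PsiHat B p τ1 τ2 γks D1 D2 l s q =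
      (∑ f : Fin k → ι, ∑ g : Fin l → ι,
        (psiSV B p τ1 τ2 (τ1 q + τ2 q) q (List.ofFn f) *
          psiSV B p τ1 τ2 (τ1 q + τ2 q) q (List.ofFn g)) *
          (Real.log (psiHat B p D1 D2 s (List.ofFn f)) +
            Real.log (psiHat B p D1 D2 s (List.ofFn g)))) := by
  unfold PsiHat
  rw [hγ k hk, hγ l hl, hγ (k + l) (by omega)]
  constructor
  · rw [sum_append k l (fun w => psiSV B p τ1 τ2 (τ1 q + τ2 q) q w *
      Real.log (psiHat B p D1 D2 s w))]
    simp only [psiSV_append B hc hd p hp τ1 τ2 q H]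
  · have e1 := h1 k hk
    have e2 := h1 l hl
    unfold PsiSV at e1 e2
    set ψ := psiSV B p τ1 τ2 (τ1 q + τ2 q) q
    set L := fun w => Real.log (psiHat B p D1 D2 s w)
    calc _ = (∑ f : Fin k → ι, ψ (List.ofFn f) * L (List.ofFn f)) *
            (∑ g : Fin l → ι, ψ (List.ofFn g)) + (∑ f : Fin k → ι, ψ (List.ofFn f)) *
            (∑ g : Fin l → ι, ψ (List.ofFn g) * L (List.ofFn g)) := by rw [e1, e2]; ring
      _ = _ := by
        rw [Finset.sum_mul_sum, Finset.sum_mul_sum, ← Finset.sum_add_distrib]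
        refine Finset.sum_congr rfl fun f _ => ?_
        rw [← Finset.sum_add_distrib]
        refine Finset.sum_congr rfl fun g _ => ?_
        simp only [L]
        ring

/-! ### Part C: a swapping map forces the two projected spectra to agree -/

lemma tau_eq_of_swap {ι : Type} [Fintype ι] (B : IFSData ι)
    (hc : ∀ i, B.c i ∈ Set.Ioo (0 : ℝ) 1) (hd : ∀ i, B.d i ∈ Set.Ioo (0 : ℝ) 1)
    (p : ι → ℝ) (hp : ∀ i, p i ∈ Set.Ioo (0 : ℝ) 1)
    (μ : Measure (ℝ × ℝ)) [IsProbabilityMeasure μ]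
    (hcpt : ∃ K : Set (ℝ × ℝ), IsCompact K ∧ μ Kᶜ = 0)
    (hself : μ = ∑ i : ι, ENNReal.ofReal (p i) • Measure.map (B.S i) μ)
    (i : ι) (hi : B.swap i = true) {q t1 t2 : ℝ} (hq : 0 < q)
    (h1 : IsLqSpec (Measure.map Prod.fst μ) q t1)
    (h2 : IsLqSpec (Measure.map Prod.snd μ) q t2) : t1 = t2 := by
  obtain ⟨K, hK, hμK⟩ := hcpt
  obtain ⟨R, hR0, hR⟩ := hK.isBounded.subset_closedBall_lt 0 0
  have P1 : IsProbabilityMeasure (Measure.map (Prod.fst : ℝ × ℝ → ℝ) μ) :=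
    Measure.isProbabilityMeasure_map measurable_fst.aemeasurable
  have P2 : IsProbabilityMeasure (Measure.map (Prod.snd : ℝ × ℝ → ℝ) μ) :=
    Measure.isProbabilityMeasure_map measurable_snd.aemeasurable
  have R1 : (Measure.map (Prod.fst : ℝ × ℝ → ℝ) μ) (Icc (-R) R)ᶜ = 0 := by
    rw [Measure.map_apply measurable_fst measurableSet_Icc.compl]
    apply measure_mono_null _ hμK
    intro x hx hxK
    apply hx
    have := hR hxK
    rw [mem_closedBall_zero_iff] at this
    exact abs_le.1 ((norm_fst_le x).trans this)
  have R2 : (Measure.map (Prod.snd : ℝ × ℝ → ℝ) μ) (Icc (-R) R)ᶜ = 0 := by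
    rw [Measure.map_apply measurable_snd measurableSet_Icc.compl]
    apply measure_mono_null _ hμK
    intro x hx hxK
    apply hx
    have := hR hxK
    rw [mem_closedBall_zero_iff] at this
    exact abs_le.1 ((norm_snd_le x).trans this)
  have hle : ENNReal.ofReal (p i) • Measure.map (B.S i) μ ≤ μ := by
    conv_rhs => rw [hself]
    exact Finset.single_le_sum (f := fun i => ENNReal.ofReal (p i) • Measure.map (B.S i) μ)
      (fun _ _ => Measure.zero_le _) (Finset.mem_univ i)
  set σ1 : ℝ := (if B.sgn1 i then 1 else -1) * B.c i with hσ1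
  set σ2 : ℝ := (if B.sgn2 i then 1 else -1) * B.d i with hσ2
  have hS : B.S i = fun x : ℝ × ℝ => (σ1 * x.2 + (B.t i).1, σ2 * x.1 + (B.t i).2) := by
    funext x
    simp only [IFSData.S, hi, if_true, hσ1, hσ2, mul_assoc]
  have n1 : σ1 ≠ 0 := mul_ne_zero (by split_ifs <;> norm_num) (hc i).1.ne'
  have n2 : σ2 ≠ 0 := mul_ne_zero (by split_ifs <;> norm_num) (hd i).1.ne'
  have mS : Measurable (B.S i) := by rw [hS]; fun_prop
  have L1 : ENNReal.ofReal (p i) • Measure.map (fun y => σ1 * y + (B.t i).1)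
      (Measure.map Prod.snd μ) ≤ Measure.map Prod.fst μ := by
    have := Measure.map_mono hle (measurable_fst (α := ℝ) (β := ℝ))
    rw [Measure.map_smul, Measure.map_map measurable_fst mS] at this
    rw [Measure.map_map (by fun_prop) measurable_snd]
    rw [hS] at this
    exact this
  have L2 : ENNReal.ofReal (p i) • Measure.map (fun y => σ2 * y + (B.t i).2)
      (Measure.map Prod.fst μ) ≤ Measure.map Prod.snd μ := by
    have := Measure.map_mono hle (measurable_snd (α := ℝ) (β := ℝ))
    rw [Measure.map_smul, Measure.map_map measurable_snd mS] at this
    rw [Measure.map_map (by fun_prop) measurable_fst]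
    rw [hS] at this
    exact this
  exact le_antisymm (tau_le _ _ hR0.le R2 R1 hq h2 h1 n2 (hp i).1 L2)
    (tau_le _ _ hR0.le R1 R2 hq h1 h2 n1 (hp i).1 L1)

theorem multiplicativity_and_additivity_of_psiHat
    {ι : Type} [Fintype ι] [Nonempty ι] (hcard : 2 ≤ Fintype.card ι)
    (B : IFSData ι)
    (hc : ∀ i, B.c i ∈ Set.Ioo (0 : ℝ) 1) (hd : ∀ i, B.d i ∈ Set.Ioo (0 : ℝ) 1)
    (p : ι → ℝ) (hp : ∀ i, p i ∈ Set.Ioo (0 : ℝ) 1) (hpsum : ∑ i : ι, p i = 1)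
    (μ : Measure (ℝ × ℝ)) [IsProbabilityMeasure μ]
    (hcpt : ∃ K : Set (ℝ × ℝ), IsCompact K ∧ μ Kᶜ = 0)
    (hself : μ = ∑ i : ι, ENNReal.ofReal (p i) • Measure.map (B.S i) μ)
    (τ1 τ2 : ℝ → ℝ)
    (hτ1 : ∀ q : ℝ, 0 ≤ q → IsLqSpec (Measure.map Prod.fst μ) q (τ1 q))
    (hτ2 : ∀ q : ℝ, 0 ≤ q → IsLqSpec (Measure.map Prod.snd μ) q (τ2 q))
    (P : ℝ → ℝ → ℝ)
    (hP : ∀ s q : ℝ, 0 ≤ q →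
      Tendsto (fun k : ℕ => PsiSV B p τ1 τ2 k s q ^ ((k : ℝ)⁻¹)) atTop (nhds (P s q)))
    (γ : ℝ → ℝ) (hγ : ∀ q : ℝ, 0 ≤ q → P (γ q) q = 1)
    (γks : ℕ → ℝ → ℝ)
    (hγks : ∀ k : ℕ, 1 ≤ k → ∀ q : ℝ, 0 ≤ q → PsiSV B p τ1 τ2 k (γks k q) q = 1)
     :
    ∀ q : ℝ, 0 < q → ∀ D1 D2 : ℝ, HasDerivAt τ1 D1 q → HasDerivAt τ2 D2 q → ∀ s : ℝ,
      (∀ i j : List ι, i ≠ [] → j ≠ [] →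
        ((s ≤ D1 + D2 →
            psiHat B p D1 D2 s (i ++ j) ≤ psiHat B p D1 D2 s i * psiHat B p D1 D2 s j) ∧
         (D1 + D2 ≤ s →
            psiHat B p D1 D2 s i * psiHat B p D1 D2 s j ≤ psiHat B p D1 D2 s (i ++ j)))) ∧
      (γ q = τ1 q + τ2 q → ∀ k l : ℕ, 1 ≤ k → 1 ≤ l →
        ((s ≤ D1 + D2 →
            PsiHat B p τ1 τ2 γks D1 D2 (k + l) s q ≤
              PsiHat B p τ1 τ2 γks D1 D2 k s q + PsiHat B p τ1 τ2 γks D1 D2 l s q) ∧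
         (D1 + D2 ≤ s →
            PsiHat B p τ1 τ2 γks D1 D2 k s q + PsiHat B p τ1 τ2 γks D1 D2 l s q ≤
              PsiHat B p τ1 τ2 γks D1 D2 (k + l) s q))) := by
  intro q hq D1 D2 hD1 hD2 s
  have HH : (∀ i, B.swap i = false) ∨ ∀ r : ℝ, 0 < r → τ1 r = τ2 r := by
    by_cases h : ∀ i, B.swap i = false
    · exact Or.inl h
    · right
      push Not at h
      obtain ⟨i, hi⟩ := h
      intro r hr
      exact tau_eq_of_swap B hc hd p hp μ hcpt hself i (by simpa using hi) hr
        (hτ1 r hr.le) (hτ2 r hr.le)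
  have HD : (∀ i, B.swap i = false) ∨ D1 = D2 := by
    refine HH.imp id fun h => ?_
    have e : τ1 =ᶠ[nhds q] τ2 := by
      filter_upwards [Ioi_mem_nhds hq] with r hr
      exact h r hr
    exact hD1.unique (hD2.congr_of_eventuallyEq e)
  have Hτ : (∀ i, B.swap i = false) ∨ τ1 q = τ2 q := HH.imp id fun h => h q hq
  have pos := psiHat_pos B hc hd p hp D1 D2 s
  refine ⟨fun i j _ _ => ?_, fun hγq k l hk hl => ?_⟩
  · have A := log_psiHat_append B hc hd p hp HD s i j
    rw [← Real.log_mul (pos i).ne' (pos j).ne'] at A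
    exact ⟨fun h => (Real.log_le_log_iff (pos _) (mul_pos (pos _) (pos _))).1 (A.1 h),
      fun h => (Real.log_le_log_iff (mul_pos (pos _) (pos _)) (pos _)).1 (A.2 h)⟩
  · have hone : PsiSV B p τ1 τ2 1 (τ1 q + τ2 q) q = 1 := by
      have T := hP (τ1 q + τ2 q) q hq.le
      rw [← hγq, hγ q hq.le, hγq] at T
      refine tendsto_nhds_unique (tendsto_const_nhds.congr' ?_) T
      filter_upwards [eventually_ge_atTop 1] with n hn
      obtain ⟨m, rfl⟩ : ∃ m, n = m + 1 := ⟨n - 1, by omega⟩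
      rw [PsiSV_pow B hc hd p hp τ1 τ2 q Hτ m]
      exact (Real.pow_rpow_inv_natCast
        (PsiSV_pos B hc hd p hp τ1 τ2 _ q 1).le (by omega)).symm
    have hall : ∀ k, 1 ≤ k → PsiSV B p τ1 τ2 k (τ1 q + τ2 q) q = 1 := by
      intro n hn
      obtain ⟨m, rfl⟩ : ∃ m, n = m + 1 := ⟨n - 1, by omega⟩
      rw [PsiSV_pow B hc hd p hp τ1 τ2 q Hτ m, hone, one_pow]
    have hγk : ∀ k, 1 ≤ k → γks k q = τ1 q + τ2 q := by
      intro n hn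
      apply (PsiSV_anti B hc hd p hp τ1 τ2 q hn).injective
      simp only
      rw [hγks n hn q hq.le, hall n hn]
    obtain ⟨E1, E2⟩ := PsiHat_expand B hc hd p hp τ1 τ2 q γks hγk hall Hτ D1 D2 s k l hk hl
    rw [E1, E2]
    have ψp := psiSV_pos B hc hd p hp τ1 τ2 (τ1 q + τ2 q) q
    constructor
    · intro h
      refine Finset.sum_le_sum fun f _ => Finset.sum_le_sum fun g _ => ?_
      exact mul_le_mul_of_nonneg_left ((log_psiHat_append B hc hd p hp HD s _ _).1 h)
        (mul_pos (ψp _) (ψp _)).le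
    · intro h
      refine Finset.sum_le_sum fun f _ => Finset.sum_le_sum fun g _ => ?_
      exact mul_le_mul_of_nonneg_left ((log_psiHat_append B hc hd p hp HD s _ _).2 h)
        (mul_pos (ψp _) (ψp _)).le
end
end

section
/- Suppose τ_1 and τ_2 are differentiable at q > 0 and γ(q) = τ_1(q)+τ_2(q), so that P̂(s,q) = lim_{k→∞} (1/k)·Ψ̂_k^{s,q} exists for every s ∈ ℝ (being inf_k (1/k)Ψ̂_k^{s,q} for s ≤ τ_1'(q)+τ_2'(q) and sup_k (1/k)Ψ̂_k^{s,q} for s ≥ τ_1'(q)+τ_2'(q)). Then: (1) for all s, t ∈ ℝ, min{s·log α_min, s·log α_max} + P̂(t,q) ≤ P̂(s+t,q) ≤ max{s·log α_min, s·log α_max} + P̂(t,q); (2) s ↦ P̂(s,q) is continuous; (3) s ↦ P̂(s,q) is strictly decreasing; (4) there is a unique s ∈ ℝ with P̂(s,q) = 0; (5) this unique s equals lim_{k→∞} γ_k'(q). -/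
open MeasureTheory Filter Set

attribute [local instance] Classical.propDecidable

noncomputable section

/-- Bounds on the side lengths of the rectangle of a word. -/
lemma dims_bounds {ι : Type} [Fintype ι] [Nonempty ι] (B : IFSData ι)
    (hc : ∀ i, B.c i ∈ Set.Ioo (0 : ℝ) 1) (hd : ∀ i, B.d i ∈ Set.Ioo (0 : ℝ) 1)
    (h0 : 0 < alphaMin B) (l : List ι) :
    (alphaMin B ^ l.length ≤ (B.dims l).1 ∧ (B.dims l).1 ≤ alphaMax B ^ l.length) ∧
    (alphaMin B ^ l.length ≤ (B.dims l).2 ∧ (B.dims l).2 ≤ alphaMax B ^ l.length) := by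
  induction l with
  | nil => simp [IFSData.dims]
  | cons i l ih =>
    have e : B.dims (i :: l) = (B.c i * (if B.swap i then (B.dims l).2 else (B.dims l).1),
      B.d i * (if B.swap i then (B.dims l).1 else (B.dims l).2)) := rfl
    have hmin : alphaMin B ≤ min (B.c i) (B.d i) := Finset.inf'_le _ (Finset.mem_univ i)
    have hmax : max (B.c i) (B.d i) ≤ alphaMax B :=
      Finset.le_sup' (fun i => max (B.c i) (B.d i)) (Finset.mem_univ i)
    have h1 := le_min_iff.1 hmin
    have h2 := max_le_iff.1 hmax
    have hc0 := (hc i).1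
    have hd0 := (hd i).1
    have hM : 0 < alphaMax B := lt_of_lt_of_le hc0 h2.1
    have hp : 0 < alphaMin B ^ l.length := pow_pos h0 _
    obtain ⟨⟨a1, a2⟩, a3, a4⟩ := ih
    have key : ∀ u v : ℝ, alphaMin B ≤ u → u ≤ alphaMax B → 0 < u →
        alphaMin B ^ l.length ≤ v → v ≤ alphaMax B ^ l.length →
        alphaMin B ^ (l.length + 1) ≤ u * v ∧ u * v ≤ alphaMax B ^ (l.length + 1) := by
      intro u v x1 x2 x3 x4 x5
      rw [pow_succ', pow_succ']
      exact ⟨mul_le_mul x1 x4 hp.le x3.le, mul_le_mul x2 x5 (hp.le.trans x4) hM.le⟩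
    rw [e, List.length_cons]
    refine ⟨?_, ?_⟩
    · split_ifs
      · exact key _ _ h1.1 h2.1 hc0 a3 a4
      · exact key _ _ h1.1 h2.1 hc0 a1 a2
    · split_ifs
      · exact key _ _ h1.2 h2.2 hd0 a1 a2
      · exact key _ _ h1.2 h2.2 hd0 a3 a4

/-- Implicit differentiation of `∑ a_f(x) b_f ^ g(x) = 1` assuming only pointwise
differentiability of the coefficients. -/
lemma implicit_deriv_s17 {κ : Type} [Fintype κ] [Nonempty κ] (a : κ → ℝ → ℝ) (a' : κ → ℝ)
    (L : κ → ℝ) (hL : ∀ f, L f < 0) (ha : ∀ f x, 0 < a f x) (q : ℝ)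
    (had : ∀ f, HasDerivAt (a f) (a' f) q) (g : ℝ → ℝ)
    (hg : ∀ᶠ x in nhds q, ∑ f, a f x * Real.exp (g x * L f) = 1) :
    HasDerivAt g (-(∑ f, Real.exp (g q * L f) * a' f) /
      (∑ f, a f q * (Real.exp (g q * L f) * L f))) q := by
  have hgq := hg.self_of_nhds
  have hanti : ∀ x s t : ℝ, s < t →
      ∑ f, a f x * Real.exp (t * L f) < ∑ f, a f x * Real.exp (s * L f) := by
    intro x s t hst
    refine Finset.sum_lt_sum_of_nonempty Finset.univ_nonempty fun f _ => ?_
    refine mul_lt_mul_of_pos_left (Real.exp_lt_exp.2 ?_) (ha f x)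
    exact mul_lt_mul_of_neg_right hst (hL f)
  have hFc : ∀ s : ℝ, ContinuousAt (fun x => ∑ f, a f x * Real.exp (s * L f)) q := by
    intro s
    refine tendsto_finsetSum _ fun f _ => ?_
    exact ((had f).continuousAt.mul continuousAt_const)
  have hcont : Tendsto g (nhds q) (nhds (g q)) := by
    refine tendsto_order.2 ⟨fun s hs => ?_, fun s hs => ?_⟩
    · have h1 : 1 < ∑ f, a f q * Real.exp (s * L f) := hgq ▸ hanti q s (g q) hs
      filter_upwards [hg, (hFc s).eventually (lt_mem_nhds h1)] with x hx h2
      by_contra hcon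
      rcases (not_lt.1 hcon).lt_or_eq with h | h
      · have := hanti x _ _ h; linarith
      · rw [h] at hx; linarith
    · have h1 : ∑ f, a f q * Real.exp (s * L f) < 1 := hgq ▸ hanti q (g q) s hs
      filter_upwards [hg, (hFc s).eventually (gt_mem_nhds h1)] with x hx h2
      by_contra hcon
      rcases (not_lt.1 hcon).lt_or_eq with h | h
      · have := hanti x _ _ h; linarith
      · rw [← h] at hx; linarith
  set F : ℝ → ℝ := fun s => ∑ f, a f q * Real.exp (s * L f) with hF
  set A : ℝ := ∑ f, a f q * (Real.exp (g q * L f) * L f) with hA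
  have hFd : HasDerivAt F A (g q) := by
    refine HasDerivAt.fun_sum fun f _ => ?_
    have := (((hasDerivAt_id (g q)).mul_const (L f)).exp).const_mul (a f q)
    simpa using this
  have hA0 : A < 0 := by
    refine Finset.sum_neg (fun f _ => ?_) Finset.univ_nonempty
    exact mul_neg_of_pos_of_neg (ha f q) (mul_neg_of_pos_of_neg (Real.exp_pos _) (hL f))
  have hds : Tendsto (fun x => dslope F (g q) (g x)) (nhds q) (nhds A) := by
    have h1 : ContinuousAt (dslope F (g q)) (g q) :=
      continuousAt_dslope_same.2 hFd.differentiableAt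
    have h2 := h1.tendsto.comp hcont
    rw [dslope_same, hFd.deriv] at h2
    exact h2
  rw [hasDerivAt_iff_tendsto_slope]
  have hnum : Tendsto (fun x => -∑ f, Real.exp (g x * L f) * slope (a f) q x)
      (nhdsWithin q {q}ᶜ) (nhds (-∑ f, Real.exp (g q * L f) * a' f)) := by
    refine (tendsto_finsetSum _ fun f _ => ?_).neg
    refine Tendsto.mul ?_ (hasDerivAt_iff_tendsto_slope.1 (had f))
    have h1 : Tendsto (fun x => g x * L f) (nhds q) (nhds (g q * L f)) := hcont.mul_const _
    exact ((Real.continuous_exp.tendsto _).comp h1).mono_left nhdsWithin_le_nhds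
  refine (hnum.div (hds.mono_left nhdsWithin_le_nhds) hA0.ne).congr' ?_
  have hne : ∀ᶠ x in nhds q, dslope F (g q) (g x) < 0 := hds.eventually (gt_mem_nhds hA0)
  filter_upwards [nhdsWithin_le_nhds hg, nhdsWithin_le_nhds hne, self_mem_nhdsWithin]
    with x hx hx2 hx3
  have hxq : x - q ≠ 0 := sub_ne_zero.2 hx3
  have e1 : (g x - g q) * dslope F (g q) (g x) = F (g x) - F (g q) := by
    simpa using sub_smul_dslope F (g q) (g x)
  have e2 : (x - q) * ∑ f, Real.exp (g x * L f) * slope (a f) q x = 1 - F (g x) := by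
    rw [← hx, hF, ← Finset.sum_sub_distrib, Finset.mul_sum]
    refine Finset.sum_congr rfl fun f _ => ?_
    rw [slope_def_field]
    field_simp
  have e3 : F (g q) = 1 := hgq
  simp only [Pi.div_apply]
  rw [slope_def_field, div_eq_div_iff hx2.ne hxq]
  linarith

theorem properties_of_Phat
    {ι : Type} [Fintype ι] [Nonempty ι] (hcard : 2 ≤ Fintype.card ι)
    (B : IFSData ι)
    (hc : ∀ i, B.c i ∈ Set.Ioo (0 : ℝ) 1) (hd : ∀ i, B.d i ∈ Set.Ioo (0 : ℝ) 1)
    (p : ι → ℝ) (hp : ∀ i, p i ∈ Set.Ioo (0 : ℝ) 1) (hpsum : ∑ i : ι, p i = 1)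
    (μ : Measure (ℝ × ℝ)) [IsProbabilityMeasure μ]
    (hcpt : ∃ K : Set (ℝ × ℝ), IsCompact K ∧ μ Kᶜ = 0)
    (hself : μ = ∑ i : ι, ENNReal.ofReal (p i) • Measure.map (B.S i) μ)
    (τ1 τ2 : ℝ → ℝ)
    (hτ1 : ∀ q : ℝ, 0 ≤ q → IsLqSpec (Measure.map Prod.fst μ) q (τ1 q))
    (hτ2 : ∀ q : ℝ, 0 ≤ q → IsLqSpec (Measure.map Prod.snd μ) q (τ2 q))
    (P : ℝ → ℝ → ℝ)
    (hP : ∀ s q : ℝ, 0 ≤ q →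
      Tendsto (fun k : ℕ => PsiSV B p τ1 τ2 k s q ^ ((k : ℝ)⁻¹)) atTop (nhds (P s q)))
    (γ : ℝ → ℝ) (hγ : ∀ q : ℝ, 0 ≤ q → P (γ q) q = 1)
    (γks : ℕ → ℝ → ℝ)
    (hγks : ∀ k : ℕ, 1 ≤ k → ∀ q : ℝ, 0 ≤ q → PsiSV B p τ1 τ2 k (γks k q) q = 1)
    (q D1 D2 : ℝ) (hq : 0 < q)
    (hD1 : HasDerivAt τ1 D1 q) (hD2 : HasDerivAt τ2 D2 q)
    (hγτ : γ q = τ1 q + τ2 q)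
    (Phat : ℝ → ℝ)
    (hPhat : ∀ s : ℝ,
      Tendsto (fun k : ℕ => PsiHat B p τ1 τ2 γks D1 D2 k s q / (k : ℝ)) atTop (nhds (Phat s)))
     :
    (∀ s t : ℝ,
        min (s * Real.log (alphaMin B)) (s * Real.log (alphaMax B)) + Phat t ≤ Phat (s + t) ∧
        Phat (s + t) ≤ max (s * Real.log (alphaMin B)) (s * Real.log (alphaMax B)) + Phat t) ∧
    Continuous Phat ∧
    StrictAnti Phat ∧
    (∃! s : ℝ, Phat s = 0) ∧
    (∀ s : ℝ, Phat s = 0 →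
      ∃ g : ℕ → ℝ, (∀ k : ℕ, 1 ≤ k → HasDerivAt (γks k) (g k) q) ∧
        Tendsto g atTop (nhds s)) := by
  classical
  have hmin0 : 0 < alphaMin B := by
    refine (Finset.lt_inf'_iff _).2 fun i _ => lt_min (hc i).1 (hd i).1
  have hmax1 : alphaMax B < 1 := by
    refine (Finset.sup'_lt_iff _).2 fun i _ => max_lt (hc i).2 (hd i).2
  have hmm : alphaMin B ≤ alphaMax B := by
    have i : ι := Classical.arbitrary ι
    exact (Finset.inf'_le _ (Finset.mem_univ i)).trans (min_le_max.trans
      (Finset.le_sup' (fun i => max (B.c i) (B.d i)) (Finset.mem_univ i)))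
  have hmax0 : 0 < alphaMax B := hmin0.trans_le hmm
  have hlogmax : Real.log (alphaMax B) < 0 := Real.log_neg hmax0 hmax1
  have hb := dims_bounds B hc hd hmin0
  have hd1 : ∀ l, 0 < (B.dims l).1 := fun l => (pow_pos hmin0 _).trans_le (hb l).1.1
  have hd2 : ∀ l, 0 < (B.dims l).2 := fun l => (pow_pos hmin0 _).trans_le (hb l).2.1
  have ha1 : ∀ l, 0 < B.alpha1 l := fun l => lt_max_of_lt_left (hd1 l)
  have ha2 : ∀ l, 0 < B.alpha2 l := fun l => lt_min (hd1 l) (hd2 l)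
  have hw : ∀ l, 0 < wordProb p l := by
    intro l
    refine List.prod_pos ?_
    intro x hx
    obtain ⟨i, _, rfl⟩ := List.mem_map.1 hx
    exact (hp i).1
  have hlo : ∀ l, (l.length : ℝ) * Real.log (alphaMin B) ≤ Real.log (B.alpha2 l) := by
    intro l
    rw [← Real.log_pow]
    exact Real.log_le_log (pow_pos hmin0 _) (le_min (hb l).1.1 (hb l).2.1)
  have hhi : ∀ l, Real.log (B.alpha2 l) ≤ (l.length : ℝ) * Real.log (alphaMax B) := by
    intro l
    rw [← Real.log_pow]
    exact Real.log_le_log (ha2 l) ((min_le_left _ _).trans (hb l).1.2)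
  have hψ : ∀ s x l, psiSV B p τ1 τ2 s x l =
      Real.exp (x * Real.log (wordProb p l) + tauW B τ1 τ2 l x * Real.log (B.alpha1 l)
        - tauW B τ1 τ2 l x * Real.log (B.alpha2 l)) * Real.exp (s * Real.log (B.alpha2 l)) := by
    intro s x l
    rw [psiSV, Real.rpow_def_of_pos (hw l), Real.rpow_def_of_pos (ha1 l),
      Real.rpow_def_of_pos (ha2 l), ← Real.exp_add, ← Real.exp_add, ← Real.exp_add]
    congr 1
    ring
  have hlog : ∀ s l, Real.log (psiHat B p D1 D2 s l) =
      (Real.log (wordProb p l) + tauWD B D1 D2 l * Real.log (B.alpha1 l)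
        - tauWD B D1 D2 l * Real.log (B.alpha2 l)) + s * Real.log (B.alpha2 l) := by
    intro s l
    have x1 := hw l
    have x2 := Real.rpow_pos_of_pos (ha1 l) (tauWD B D1 D2 l)
    have x3 := Real.rpow_pos_of_pos (ha2 l) (s - tauWD B D1 D2 l)
    rw [psiHat, Real.log_mul (mul_pos x1 x2).ne' x3.ne', Real.log_mul x1.ne' x2.ne',
      Real.log_rpow (ha1 l), Real.log_rpow (ha2 l)]
    ring
  obtain ⟨A, hA⟩ : ∃ A : ℕ → ℝ, ∀ k, A k = ∑ f : Fin k → ι,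
    psiSV B p τ1 τ2 (γks k q) q (List.ofFn f) * Real.log (B.alpha2 (List.ofFn f)) :=
    ⟨_, fun _ => rfl⟩
  have hlin : ∀ k s t, PsiHat B p τ1 τ2 γks D1 D2 k (s + t) q =
      PsiHat B p τ1 τ2 γks D1 D2 k t q + s * A k := by
    intro k s t
    rw [PsiHat, PsiHat, hA, Finset.mul_sum, ← Finset.sum_add_distrib]
    refine Finset.sum_congr rfl fun f _ => ?_
    rw [hlog, hlog]
    ring
  have hpos : ∀ s x l, 0 < psiSV B p τ1 τ2 s x l := by
    intro s x l
    rw [hψ]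
    exact mul_pos (Real.exp_pos _) (Real.exp_pos _)
  have hAlo : ∀ k, 1 ≤ k → Real.log (alphaMin B) ≤ A k / k := by
    intro k hk
    have hk0 : (0 : ℝ) < k := by exact_mod_cast hk
    rw [le_div_iff₀ hk0, hA]
    have h1 : Real.log (alphaMin B) * k = ∑ f : Fin k → ι,
        psiSV B p τ1 τ2 (γks k q) q (List.ofFn f) * (Real.log (alphaMin B) * k) := by
      rw [← Finset.sum_mul]
      have := hγks k hk q hq.le
      rw [PsiSV] at this
      rw [this, one_mul]
    rw [h1]
    refine Finset.sum_le_sum fun f _ => mul_le_mul_of_nonneg_left ?_ (hpos _ _ _).le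
    have := hlo (List.ofFn f)
    rw [List.length_ofFn] at this
    linarith
  have hAhi : ∀ k, 1 ≤ k → A k / k ≤ Real.log (alphaMax B) := by
    intro k hk
    have hk0 : (0 : ℝ) < k := by exact_mod_cast hk
    rw [div_le_iff₀ hk0, hA]
    have h1 : Real.log (alphaMax B) * k = ∑ f : Fin k → ι,
        psiSV B p τ1 τ2 (γks k q) q (List.ofFn f) * (Real.log (alphaMax B) * k) := by
      rw [← Finset.sum_mul]
      have := hγks k hk q hq.le
      rw [PsiSV] at this
      rw [this, one_mul]
    rw [h1]
    refine Finset.sum_le_sum fun f _ => mul_le_mul_of_nonneg_left ?_ (hpos _ _ _).le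
    have := hhi (List.ofFn f)
    rw [List.length_ofFn] at this
    linarith
  obtain ⟨a, ha⟩ : ∃ a, Tendsto (fun k : ℕ => A k / (k : ℝ)) atTop (nhds a) := by
    refine ⟨Phat (1 + 0) - Phat 0, ((hPhat (1 + 0)).sub (hPhat 0)).congr fun k => ?_⟩
    rw [hlin]
    ring
  have halo : Real.log (alphaMin B) ≤ a :=
    ge_of_tendsto ha (eventually_atTop.2 ⟨1, hAlo⟩)
  have hahi : a ≤ Real.log (alphaMax B) :=
    le_of_tendsto ha (eventually_atTop.2 ⟨1, hAhi⟩)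
  have ha0 : a < 0 := hahi.trans_lt hlogmax
  have haff : ∀ s t, Phat (s + t) = Phat t + s * a := by
    intro s t
    refine tendsto_nhds_unique (hPhat (s + t)) (((hPhat t).add (ha.const_mul s)).congr fun k => ?_)
    rw [hlin]
    ring
  have haff0 : ∀ s, Phat s = Phat 0 + s * a := by
    intro s
    have := haff s 0
    rwa [add_zero] at this
  refine ⟨fun s t => ?_, ?_, ?_, ?_, ?_⟩
  · rw [haff]
    rcases le_total 0 s with hs | hs
    · have h1 := mul_le_mul_of_nonneg_left halo hs
      have h2 := mul_le_mul_of_nonneg_left hahi hs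
      have h3 := min_le_left (s * Real.log (alphaMin B)) (s * Real.log (alphaMax B))
      have h4 := le_max_right (s * Real.log (alphaMin B)) (s * Real.log (alphaMax B))
      constructor <;> linarith
    · have h1 := mul_le_mul_of_nonpos_left halo hs
      have h2 := mul_le_mul_of_nonpos_left hahi hs
      have h3 := min_le_right (s * Real.log (alphaMin B)) (s * Real.log (alphaMax B))
      have h4 := le_max_left (s * Real.log (alphaMin B)) (s * Real.log (alphaMax B))
      constructor <;> linarith
  · rw [funext haff0]
    fun_prop
  · intro s t hst
    rw [haff0 s, haff0 t]
    have := mul_lt_mul_of_neg_right hst ha0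
    linarith
  · refine ⟨-Phat 0 / a, ?_, fun s hs => ?_⟩
    · change Phat _ = 0
      rw [haff0, div_mul_cancel₀ _ ha0.ne]
      ring
    · rw [eq_div_iff ha0.ne]
      have := haff0 s
      linarith
  · intro s hs
    refine ⟨fun k => -PsiHat B p τ1 τ2 γks D1 D2 k 0 q / A k, fun k hk => ?_, ?_⟩
    · have hτ : ∀ l, HasDerivAt (tauW B τ1 τ2 l) (tauWD B D1 D2 l) q := by
        intro l
        by_cases h : B.usesPi1 l
        · have : tauW B τ1 τ2 l = τ1 := by funext x; simp [tauW, h]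
          rw [this]
          simpa [tauWD, h] using hD1
        · have : tauW B τ1 τ2 l = τ2 := by funext x; simp [tauW, h]
          rw [this]
          simpa [tauWD, h] using hD2
      have hneg : ∀ f : Fin k → ι, Real.log (B.alpha2 (List.ofFn f)) < 0 := by
        intro f
        have h1 := hhi (List.ofFn f)
        rw [List.length_ofFn] at h1
        have hk0 : (0 : ℝ) < k := by exact_mod_cast hk
        exact h1.trans_lt (mul_neg_of_pos_of_neg hk0 hlogmax)
      have had := fun f : Fin k → ι =>
        (((((hasDerivAt_id q).mul_const (Real.log (wordProb p (List.ofFn f)))).add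
          ((hτ (List.ofFn f)).mul_const (Real.log (B.alpha1 (List.ofFn f))))).sub
          ((hτ (List.ofFn f)).mul_const (Real.log (B.alpha2 (List.ofFn f))))).exp)
      have key := implicit_deriv_s17 (κ := Fin k → ι) _ _
        (fun f => Real.log (B.alpha2 (List.ofFn f))) hneg (fun f x => Real.exp_pos _) q had
        (γks k) (by
          filter_upwards [lt_mem_nhds hq] with x hx
          rw [← hγks k hk x hx.le, PsiSV]
          refine Finset.sum_congr rfl fun f _ => ?_
          rw [hψ]
          rfl)
      refine key.congr_deriv (Eq.symm ?_)
      beta_reduce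
      refine congrArg₂ (fun u v : ℝ => -u / v) ?_ ?_
      · rw [PsiHat]
        refine Finset.sum_congr rfl fun f _ => ?_
        rw [hlog, hψ]
        simp only [Pi.add_apply, Pi.sub_apply, id]
        ring
      · rw [hA]
        refine Finset.sum_congr rfl fun f _ => ?_
        rw [hψ]
        simp only [Pi.add_apply, Pi.sub_apply, id]
        ring
    · have h1 := ((hPhat 0).neg.div ha ha0.ne)
      have h2 : -Phat 0 / a = s := by
        rw [div_eq_iff ha0.ne]
        have := haff0 s
        linarith
      rw [h2] at h1
      refine h1.congr' ?_
      filter_upwards [eventually_ge_atTop 1] with k hk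
      have hk0 : (k : ℝ) ≠ 0 := by
        have : (0 : ℝ) < k := by exact_mod_cast hk
        exact this.ne'
      simp only [Pi.div_apply]
      rw [← neg_div, div_div_div_cancel_right₀ hk0]
end
end

section
/- Suppose τ_1 and τ_2 are differentiable at q = 1. Then the derivatives γ_k'(1) exist for all k ∈ ℕ and the sequence (γ_k'(1))_{k∈ℕ} converges as k → ∞. -/
open MeasureTheory Filter Set

attribute [local instance] Classical.propDecidable

noncomputable section

namespace GK

lemma implicit_deriv (Φ : ℝ → ℝ → ℝ) (γ : ℝ → ℝ) (N a : ℝ) (ha : 0 < a)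
    (anti : ∀ q, StrictAnti (fun s => Φ s q))
    (hγ : ∀ q, 0 ≤ q → Φ (γ q) q = 1) (h10 : Φ 0 1 = 1)
    (hder : ∀ c, HasDerivAt (fun q => Φ (c * (q - 1)) q) (N - c * a) 1) :
    HasDerivAt γ (N / a) 1 := by
  have h1 : γ 1 = 0 := (anti 1).injective (by simp only [hγ 1 zero_le_one, h10])
  rw [hasDerivAt_iff_isLittleO, Asymptotics.isLittleO_iff]
  intro ε hε
  have hp := (hder (N / a + ε))
  have hm := (hder (N / a - ε))
  rw [hasDerivAt_iff_isLittleO, Asymptotics.isLittleO_iff] at hp hm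
  have hea : 0 < ε * a / 2 := by positivity
  filter_upwards [hp hea, hm hea, eventually_ge_nhds (zero_lt_one' ℝ)] with q hq1 hq2 hq0
  have e1 : N - (N / a + ε) * a = - (ε * a) := by field_simp; ring
  have e2 : N - (N / a - ε) * a = ε * a := by field_simp; ring
  simp only [sub_self, mul_zero, h10, e1, e2, smul_eq_mul, Real.norm_eq_abs, h1] at hq1 hq2 ⊢
  have hg := hγ q hq0
  rcases lt_trichotomy q 1 with h | h | h
  · rw [abs_of_neg (sub_neg.2 h)] at hq1 hq2 ⊢
    have pos : 0 < ε * a * (1 - q) := mul_pos (mul_pos hε ha) (by linarith)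
    have k1 : (N / a + ε) * (q - 1) < γ q := by
      apply (anti q).lt_iff_gt.1
      simp only [hg]
      have := (abs_le.1 hq1).1
      nlinarith
    have k2 : γ q < (N / a - ε) * (q - 1) := by
      apply (anti q).lt_iff_gt.1
      simp only [hg]
      have := (abs_le.1 hq2).2
      nlinarith
    rw [abs_le]
    constructor <;> nlinarith
  · subst h; simp [h1]
  · rw [abs_of_pos (sub_pos.2 h)] at hq1 hq2 ⊢
    have pos : 0 < ε * a * (q - 1) := mul_pos (mul_pos hε ha) (by linarith)
    have k1 : γ q < (N / a + ε) * (q - 1) := by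
      apply (anti q).lt_iff_gt.1
      simp only [hg]
      have := (abs_le.1 hq1).2
      nlinarith
    have k2 : (N / a - ε) * (q - 1) < γ q := by
      apply (anti q).lt_iff_gt.1
      simp only [hg]
      have := (abs_le.1 hq2).1
      nlinarith
    rw [abs_le]
    constructor <;> nlinarith

lemma tau_one (ν : Measure ℝ) [IsProbabilityMeasure ν] (t : ℝ) (h : IsLqSpec ν 1 t) : t = 0 := by
  have := h.1
  simp [lowerLq] at this
  exact this.symm

section words
variable {ι : Type} [Fintype ι] (B : IFSData ι) (p : ι → ℝ)

/-- expectation over words of length `k` -/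
def E (k : ℕ) (φ : List ι → ℝ) : ℝ := ∑ f : Fin k → ι, wordProb p (List.ofFn f) * φ (List.ofFn f)

lemma E_zero (φ : List ι → ℝ) : E p 0 φ = φ [] := by
  simp [E, wordProb]

lemma E_succ (k : ℕ) (φ : List ι → ℝ) :
    E p (k + 1) φ = ∑ i, p i * E p k (fun l => φ (i :: l)) := by
  unfold E
  rw [← (Fin.consEquiv (fun _ : Fin (k + 1) => ι)).sum_comp, Fintype.sum_prod_type]
  refine Finset.sum_congr rfl fun i _ => ?_
  rw [Finset.mul_sum]
  refine Finset.sum_congr rfl fun f _ => ?_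
  simp [Fin.consEquiv, List.ofFn_succ, wordProb]
  ring

lemma E_add (φ ψ : List ι → ℝ) (k : ℕ) : E p k (fun l => φ l + ψ l) = E p k φ + E p k ψ := by
  simp [E, mul_add, Finset.sum_add_distrib]

lemma E_mul (c : ℝ) (φ : List ι → ℝ) (k : ℕ) : E p k (fun l => c * φ l) = c * E p k φ := by
  simp only [E, Finset.mul_sum]
  exact Finset.sum_congr rfl fun f _ => by ring

lemma E_append (m n : ℕ) (φ : List ι → ℝ) :
    E p (m + n) φ = E p m (fun l => E p n (fun l' => φ (l ++ l'))) := by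
  induction m generalizing φ with
  | zero => simp [E_zero]
  | succ m ih =>
    rw [show m + 1 + n = (m + n) + 1 by ring, E_succ, E_succ]
    simp only [ih, List.cons_append]

variable {p} in
lemma wordProb_pos (hp : ∀ i, 0 < p i) (l : List ι) : 0 < wordProb p l := by
  induction l with
  | nil => simp [wordProb]
  | cons i l ih => simpa [wordProb] using mul_pos (hp i) ih

variable {p} in
lemma E_mono (hp : ∀ i, 0 < p i) {φ ψ : List ι → ℝ} (h : ∀ l, φ l ≤ ψ l) (k : ℕ) :
    E p k φ ≤ E p k ψ :=
  Finset.sum_le_sum fun f _ => mul_le_mul_of_nonneg_left (h _) (wordProb_pos hp _).le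

variable {p} in
lemma E_const (hs : ∑ i, p i = 1) (c : ℝ) (k : ℕ) : E p k (fun _ => c) = c := by
  induction k with
  | zero => simp [E_zero]
  | succ k ih => rw [E_succ, ih, ← Finset.sum_mul, hs, one_mul]

variable {p} in
lemma E_additive (hs : ∑ i, p i = 1) (φ : List ι → ℝ) (x : ι → ℝ) (h0 : φ [] = 0)
    (h : ∀ i l, φ (i :: l) = x i + φ l) (k : ℕ) : E p k φ = k * ∑ i, p i * x i := by
  induction k with
  | zero => simp [E_zero, h0]
  | succ k ih =>
    rw [E_succ]
    simp only [h, E_add, E_const hs, ih, mul_add, Finset.sum_add_distrib, ← Finset.sum_mul, hs]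
    push_cast; ring

/-- sign of the permutation part of a word -/
def eps (l : List ι) : ℝ := if B.swapW l then -1 else 1

/-- signed log-eccentricity -/
def X (l : List ι) : ℝ := eps B l * (Real.log (B.dims l).1 - Real.log (B.dims l).2)

/-- sign of a letter -/
def e1 (i : ι) : ℝ := if B.swap i then -1 else 1

lemma eps_cons (i : ι) (l : List ι) : eps B (i :: l) = e1 B i * eps B l := by
  have : B.swapW (i :: l) = xor (B.swap i) (B.swapW l) := rfl
  unfold eps e1
  rw [this]
  cases B.swap i <;> cases B.swapW l <;> simp

lemma dims_cons (i : ι) (l : List ι) : B.dims (i :: l) =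
    (B.c i * (if B.swap i then (B.dims l).2 else (B.dims l).1),
      B.d i * (if B.swap i then (B.dims l).1 else (B.dims l).2)) := rfl

lemma dims_append (l l' : List ι) : B.dims (l ++ l') =
    ((B.dims l).1 * (if B.swapW l then (B.dims l').2 else (B.dims l').1),
      (B.dims l).2 * (if B.swapW l then (B.dims l').1 else (B.dims l').2)) := by
  induction l with
  | nil => simp [IFSData.dims, IFSData.swapW]
  | cons i l ih =>
    have : B.swapW (i :: l) = xor (B.swap i) (B.swapW l) := rfl
    rw [List.cons_append, dims_cons, ih, this, dims_cons]
    cases B.swap i <;> cases B.swapW l <;> simp [mul_assoc]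

variable {B}
variable (hc : ∀ i, B.c i ∈ Set.Ioo (0 : ℝ) 1) (hd : ∀ i, B.d i ∈ Set.Ioo (0 : ℝ) 1)
include hc hd

lemma dims_pos (l : List ι) : 0 < (B.dims l).1 ∧ 0 < (B.dims l).2 := by
  induction l with
  | nil => simp [IFSData.dims]
  | cons i l ih =>
    rw [dims_cons]
    have := (hc i).1
    have := (hd i).1
    obtain ⟨h1, h2⟩ := ih
    cases B.swap i <;> simp <;> constructor <;> positivity

lemma dims_le (l : List ι) : (B.dims l).1 ≤ 1 ∧ (B.dims l).2 ≤ 1 := by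
  induction l with
  | nil => simp [IFSData.dims]
  | cons i l ih =>
    have := dims_pos hc hd l
    rw [dims_cons]
    cases B.swap i <;> simp <;> constructor <;>
      apply mul_le_one₀ <;> linarith [(hc i).2, (hd i).2, ih.1, ih.2]

lemma alpha2_pos (l : List ι) : 0 < B.alpha2 l :=
  lt_min (dims_pos hc hd l).1 (dims_pos hc hd l).2

lemma alpha1_pos (l : List ι) : 0 < B.alpha1 l :=
  lt_max_of_lt_left (dims_pos hc hd l).1

lemma alpha2_lt (i : ι) (l : List ι) : B.alpha2 (i :: l) < 1 := by
  apply min_lt_of_left_lt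
  have h1 := dims_pos hc hd l
  have h2 := dims_le hc hd l
  rw [dims_cons]
  have := hc i
  obtain ⟨h3, h4⟩ := this
  cases B.swap i <;> simp <;> nlinarith

lemma alpha2_append (l l' : List ι) : B.alpha2 l * B.alpha2 l' ≤ B.alpha2 (l ++ l') := by
  have h1 := dims_pos hc hd l
  have h2 := alpha2_pos hc hd l'
  unfold IFSData.alpha2 at *
  rw [dims_append]
  apply le_min
  · apply mul_le_mul (min_le_left _ _) _ h2.le h1.1.le
    cases B.swapW l <;> simp
  · apply mul_le_mul (min_le_right _ _) _ h2.le h1.2.le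
    cases B.swapW l <;> simp

lemma log_dims_cons (i : ι) (l : List ι) :
    Real.log (B.dims (i :: l)).1 + Real.log (B.dims (i :: l)).2 =
      (Real.log (B.c i) + Real.log (B.d i)) +
        (Real.log (B.dims l).1 + Real.log (B.dims l).2) := by
  have h1 := dims_pos hc hd l
  rw [dims_cons]
  cases B.swap i <;> simp <;>
  rw [Real.log_mul (hc i).1.ne' (by linarith), Real.log_mul (hd i).1.ne' (by linarith)] <;> ring

lemma X_cons (i : ι) (l : List ι) :
    X B (i :: l) = X B l + e1 B i * (Real.log (B.c i) - Real.log (B.d i)) * eps B l := by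
  have h1 := dims_pos hc hd l
  unfold X
  rw [dims_cons, eps_cons]
  unfold e1
  cases B.swap i <;> simp <;>
  rw [Real.log_mul (hc i).1.ne' (by linarith), Real.log_mul (hd i).1.ne' (by linarith)] <;> ring

lemma log_sum (l : List ι) : Real.log (B.alpha1 l) + Real.log (B.alpha2 l) =
    Real.log (B.dims l).1 + Real.log (B.dims l).2 := by
  unfold IFSData.alpha1 IFSData.alpha2
  rcases le_total (B.dims l).1 (B.dims l).2 with h | h <;> simp [h]; ring

lemma uses_iff (D1 D2 : ℝ) (l : List ι) :
    (if B.usesPi1 l then D1 else D2) * (Real.log (B.alpha1 l) - Real.log (B.alpha2 l)) =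
      (D1 + D2) / 2 * (Real.log (B.dims l).1 + Real.log (B.dims l).2)
        + -(D1 + D2) * Real.log (B.alpha2 l) + (D1 - D2) / 2 * X B l := by
  unfold IFSData.usesPi1 X eps IFSData.alpha1 IFSData.alpha2
  rcases lt_trichotomy (B.dims l).1 (B.dims l).2 with h | h | h
  · have := h.le
    have := h.not_ge
    cases B.swapW l <;> simp [*] <;> ring
  · cases B.swapW l <;> simp [h] <;> ring
  · have := h.le
    have := h.not_gt
    cases B.swapW l <;> simp [*] <;> ring

omit hc hd in
lemma E_eps (k : ℕ) : E p k (eps B) = (∑ i, p i * e1 B i) ^ k := by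
  induction k with
  | zero => simp [E_zero, eps, IFSData.swapW]
  | succ k ih =>
    rw [E_succ]
    simp only [eps_cons, E_mul, ih, pow_succ']
    rw [Finset.sum_mul]
    exact Finset.sum_congr rfl fun i _ => by ring

lemma E_X (hs : ∑ i, p i = 1) (k : ℕ) :
    E p k (X B) = (∑ i, p i * (e1 B i * (Real.log (B.c i) - Real.log (B.d i)))) *
      ∑ j ∈ Finset.range k, (∑ i, p i * e1 B i) ^ j := by
  induction k with
  | zero => simp [E_zero, X, IFSData.dims]
  | succ k ih =>
    rw [E_succ, Finset.sum_range_succ, mul_add, ← ih]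
    simp only [X_cons hc hd, E_add, E_mul, E_eps]
    simp only [mul_add, Finset.sum_add_distrib, ← Finset.sum_mul, hs, one_mul, ← mul_assoc]

end words

lemma geom_avg (r : ℝ) (hr : |r| ≤ 1) :
    ∃ L, Tendsto (fun k : ℕ => (∑ j ∈ Finset.range k, r ^ j) / (k : ℝ)) atTop (nhds L) := by
  by_cases h1 : r = 1
  · refine ⟨1, tendsto_const_nhds.congr' ?_⟩
    filter_upwards [eventually_gt_atTop 0] with k hk
    have : (k : ℝ) ≠ 0 := by positivity
    simp [h1, this]
  · refine ⟨0, ?_⟩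
    apply squeeze_zero_norm (a := fun k : ℕ => (2 / |r - 1|) / (k : ℝ))
    · intro k
      rw [geom_sum_eq h1, norm_div, norm_div, Real.norm_eq_abs, Real.norm_eq_abs, RCLike.norm_natCast]
      gcongr
      calc |r ^ k - 1| ≤ |r ^ k| + |1| := abs_sub _ _
        _ ≤ 2 := by
          rw [abs_pow, abs_one]
          linarith [pow_le_one₀ (n := k) (abs_nonneg r) hr]
    · exact tendsto_const_div_atTop_nhds_zero_nat _

end GK

theorem gamma_k_derivatives_converge_at_one
    {ι : Type} [Fintype ι] [Nonempty ι] (hcard : 2 ≤ Fintype.card ι)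
    (B : IFSData ι)
    (hc : ∀ i, B.c i ∈ Set.Ioo (0 : ℝ) 1) (hd : ∀ i, B.d i ∈ Set.Ioo (0 : ℝ) 1)
    (p : ι → ℝ) (hp : ∀ i, p i ∈ Set.Ioo (0 : ℝ) 1) (hpsum : ∑ i : ι, p i = 1)
    (μ : Measure (ℝ × ℝ)) [IsProbabilityMeasure μ]
    (hcpt : ∃ K : Set (ℝ × ℝ), IsCompact K ∧ μ Kᶜ = 0)
    (hself : μ = ∑ i : ι, ENNReal.ofReal (p i) • Measure.map (B.S i) μ)
    (τ1 τ2 : ℝ → ℝ)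
    (hτ1 : ∀ q : ℝ, 0 ≤ q → IsLqSpec (Measure.map Prod.fst μ) q (τ1 q))
    (hτ2 : ∀ q : ℝ, 0 ≤ q → IsLqSpec (Measure.map Prod.snd μ) q (τ2 q))
    (γks : ℕ → ℝ → ℝ)
    (hγks : ∀ k : ℕ, 1 ≤ k → ∀ q : ℝ, 0 ≤ q → PsiSV B p τ1 τ2 k (γks k q) q = 1)
     :
    ∀ D1 D2 : ℝ, HasDerivAt τ1 D1 1 → HasDerivAt τ2 D2 1 →
      ∃ g : ℕ → ℝ, (∀ k : ℕ, 1 ≤ k → HasDerivAt (γks k) (g k) 1) ∧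
        ∃ L : ℝ, Tendsto g atTop (nhds L) := by
  intro D1 D2 hD1 hD2
  have hp0 : ∀ i, 0 < p i := fun i => (hp i).1
  have t1 : τ1 1 = 0 := by
    haveI := Measure.isProbabilityMeasure_map (μ := μ) (measurable_fst (α := ℝ) (β := ℝ)).aemeasurable
    exact GK.tau_one _ _ (hτ1 1 zero_le_one)
  have t2 : τ2 1 = 0 := by
    haveI := Measure.isProbabilityMeasure_map (μ := μ) (measurable_snd (α := ℝ) (β := ℝ)).aemeasurable
    exact GK.tau_one _ _ (hτ2 1 zero_le_one)
  have tW : ∀ l, tauW B τ1 τ2 l 1 = 0 := fun l => by simp [tauW, t1, t2]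
  have tD : ∀ l, HasDerivAt (fun q => tauW B τ1 τ2 l q) (if B.usesPi1 l then D1 else D2) 1 := by
    intro l
    unfold tauW
    by_cases h : B.usesPi1 l <;> simpa [h]
  -- the subadditive sequence
  set a : ℕ → ℝ := fun k => GK.E p k (fun l => -Real.log (B.alpha2 l)) with ha
  have ha0 : a 0 = 0 := by simp [ha, GK.E_zero, IFSData.alpha2, IFSData.dims]
  have hsub : Subadditive a := by
    intro m n
    have : ∀ l l' : List ι, -Real.log (B.alpha2 (l ++ l')) ≤
        -Real.log (B.alpha2 l) + -Real.log (B.alpha2 l') := by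
      intro l l'
      have h1 := GK.alpha2_pos hc hd l
      have h2 := GK.alpha2_pos hc hd l'
      have := Real.log_le_log (mul_pos h1 h2) (GK.alpha2_append hc hd l l')
      rw [Real.log_mul h1.ne' h2.ne'] at this
      linarith
    calc a (m + n) = GK.E p m (fun l => GK.E p n (fun l' => -Real.log (B.alpha2 (l ++ l')))) :=
          GK.E_append p m n _
      _ ≤ GK.E p m (fun l => -Real.log (B.alpha2 l) + a n) := by
          refine GK.E_mono hp0 (fun l => ?_) m
          refine (GK.E_mono hp0 (this l) n).trans ?_
          rw [GK.E_add, GK.E_const hpsum]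
      _ = a m + a n := by rw [GK.E_add, GK.E_const hpsum]
  set W : ℝ := ∑ i, p i * (Real.log (B.c i) + Real.log (B.d i)) with hW
  have hEW : ∀ k, GK.E p k (fun l => Real.log (B.dims l).1 + Real.log (B.dims l).2) = k * W := by
    intro k
    exact GK.E_additive hpsum _ (fun i => Real.log (B.c i) + Real.log (B.d i))
      (by simp [IFSData.dims]) (fun i l => GK.log_dims_cons hc hd i l) k
  have hWneg : W < 0 := by
    apply Finset.sum_neg (fun i _ => ?_) Finset.univ_nonempty
    have h1 := Real.log_neg (hc i).1 (hc i).2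
    have h2 := Real.log_neg (hd i).1 (hd i).2
    exact mul_neg_of_pos_of_neg (hp0 i) (by linarith)
  have halow : ∀ k : ℕ, k * (-W / 2) ≤ a k := by
    intro k
    have : GK.E p k (fun l => (-1 / 2) * (Real.log (B.dims l).1 + Real.log (B.dims l).2)) ≤ a k := by
      refine GK.E_mono hp0 (fun l => ?_) k
      have h0 := GK.alpha2_pos hc hd l
      have h1 := Real.log_le_log h0 (min_le_left (B.dims l).1 (B.dims l).2)
      have h2 := Real.log_le_log h0 (min_le_right (B.dims l).1 (B.dims l).2)
      change Real.log (B.alpha2 l) ≤ _ at h1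
      change Real.log (B.alpha2 l) ≤ _ at h2
      linarith
    rw [GK.E_mul, hEW] at this
    linarith
  have hapos : ∀ k : ℕ, 1 ≤ k → 0 < a k := by
    intro k hk
    have : (0 : ℝ) < k := by exact_mod_cast hk
    exact lt_of_lt_of_le (mul_pos this (by linarith)) (halow k)
  have hbdd : BddBelow (Set.range fun n => a n / n) := by
    refine ⟨0, ?_⟩
    rintro _ ⟨n, rfl⟩
    rcases Nat.eq_zero_or_pos n with h | h
    · simp [h]
    · have := hapos n h
      positivity
  have hlim := hsub.tendsto_lim hbdd
  have hlimpos : 0 < hsub.lim := by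
    refine lt_of_lt_of_le (show 0 < -W / 2 by linarith) (ge_of_tendsto hlim ?_)
    filter_upwards [eventually_gt_atTop 0] with k hk
    have : (0 : ℝ) < k := by exact_mod_cast hk
    rw [le_div_iff₀ this]
    linarith [halow k]
  -- the numerator
  set N : ℕ → ℝ := fun k => GK.E p k (fun l => Real.log (wordProb p l) +
    (if B.usesPi1 l then D1 else D2) * (Real.log (B.alpha1 l) - Real.log (B.alpha2 l))) with hN
  obtain ⟨Lg, hLg⟩ := GK.geom_avg (∑ i, p i * GK.e1 B i) (by
    refine (Finset.abs_sum_le_sum_abs _ _).trans ?_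
    rw [← hpsum]
    refine Finset.sum_le_sum fun i _ => ?_
    rw [abs_mul, abs_of_pos (hp0 i)]
    unfold GK.e1
    cases B.swap i <;> simp)
  set x : ℝ := ∑ i, p i * (GK.e1 B i * (Real.log (B.c i) - Real.log (B.d i))) with hx
  set H : ℝ := ∑ i, p i * Real.log (p i) with hH
  have hNk : ∀ k : ℕ, N k = k * H + ((D1 + D2) / 2 * (k * W) + (D1 + D2) * a k +
      (D1 - D2) / 2 * (x * ∑ j ∈ Finset.range k, (∑ i, p i * GK.e1 B i) ^ j)) := by
    intro k
    have hlogp : GK.E p k (fun l => Real.log (wordProb p l)) = k * H := by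
      refine GK.E_additive hpsum _ (fun i => Real.log (p i)) (by simp [wordProb]) (fun i l => ?_) k
      have := (GK.wordProb_pos hp0 l).ne'
      rw [← Real.log_mul (hp0 i).ne' this]
      simp [wordProb]
    have hal : a k = - GK.E p k (fun l => Real.log (B.alpha2 l)) := by
      have := GK.E_mul p (-1) (fun l => Real.log (B.alpha2 l)) k
      simpa [ha] using this
    simp only [hN, GK.uses_iff hc hd, GK.E_add, hlogp, GK.E_mul, hEW, GK.E_X p hc hd hpsum, hal]
    ring
  refine ⟨fun k => N k / a k, ?_, (H + ((D1 + D2) / 2 * W + (D1 + D2) * hsub.lim +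
      (D1 - D2) / 2 * (x * Lg))) / hsub.lim, ?_⟩
  · intro k hk
    refine GK.implicit_deriv (fun s q => PsiSV B p τ1 τ2 k s q) _ _ _ (hapos k hk) ?_ (hγks k hk) ?_ ?_
    · intro q s s' hss
      refine Finset.sum_lt_sum_of_nonempty Finset.univ_nonempty fun f _ => ?_
      unfold psiSV
      obtain ⟨k, rfl⟩ : ∃ m, k = m + 1 := ⟨k - 1, by omega⟩
      have h1 := GK.wordProb_pos hp0 (List.ofFn f)
      have h2 := GK.alpha1_pos hc hd (List.ofFn f)
      have h3 := GK.alpha2_pos hc hd (List.ofFn f)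
      have h4 : B.alpha2 (List.ofFn f) < 1 := by
        rw [List.ofFn_succ]
        exact GK.alpha2_lt hc hd _ _
      have h5 := Real.rpow_lt_rpow_of_exponent_gt h3 h4
        (show s - tauW B τ1 τ2 (List.ofFn f) q < s' - tauW B τ1 τ2 (List.ofFn f) q by linarith)
      exact mul_lt_mul_of_pos_left h5 (by positivity)
    · have := GK.E_const hpsum 1 k
      simpa [PsiSV, psiSV, tW, GK.E] using this
    · intro c
      have key : N k - c * a k = GK.E p k (fun l => (Real.log (wordProb p l) +
          (if B.usesPi1 l then D1 else D2) * (Real.log (B.alpha1 l) - Real.log (B.alpha2 l))) +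
          (-c) * (-Real.log (B.alpha2 l))) := by
        rw [GK.E_add, GK.E_mul]
        simp only [hN, ha]
        ring
      rw [key]
      unfold PsiSV GK.E
      refine HasDerivAt.fun_sum fun f _ => ?_
      generalize List.ofFn f = l
      have h1 := GK.wordProb_pos hp0 l
      have h2 := GK.alpha1_pos hc hd l
      have h3 := GK.alpha2_pos hc hd l
      unfold psiSV
      have d1 := (hasDerivAt_id (1 : ℝ)).const_rpow (a := wordProb p l) h1
      have d2 := (tD l).const_rpow (a := B.alpha1 l) h2
      have d3 := ((((hasDerivAt_id (1 : ℝ)).sub_const 1).const_mul c).sub (tD l)).const_rpow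
        (a := B.alpha2 l) h3
      have d := (d1.mul d2).mul d3
      refine d.congr_deriv ?_
      by_cases hu : B.usesPi1 l <;> simp [tW, hu] <;> ring
  · have hT : Tendsto (fun k : ℕ => (H + ((D1 + D2) / 2 * W + (D1 + D2) * (a k / k) +
        (D1 - D2) / 2 * (x * ((∑ j ∈ Finset.range k, (∑ i, p i * GK.e1 B i) ^ j) / k)))) /
        (a k / k)) atTop (nhds ((H + ((D1 + D2) / 2 * W + (D1 + D2) * hsub.lim +
      (D1 - D2) / 2 * (x * Lg))) / hsub.lim)) := by
      refine Tendsto.div ?_ hlim hlimpos.ne'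
      exact tendsto_const_nhds.add ((tendsto_const_nhds.add (hlim.const_mul _)).add
        ((hLg.const_mul x).const_mul _))
    refine hT.congr' ?_
    filter_upwards [eventually_gt_atTop 0] with k hk
    have hk' : (k : ℝ) ≠ 0 := by positivity
    have := (hapos k hk).ne'
    rw [hNk k]
    field_simp
end
end
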